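/- Any artinian Gorenstein algebra A of codimension 3 with odd socle degree 2m+1 (m ≥ 1) and h-vector (1, 3, 6, 8, 10, ..., 2m, 2m+2, 2m+2, 2m, ..., 10, 8, 6, 3, 1) satisfies the weak Lefschetz property. -/

import Mathlib

open MvPolynomial

noncomputable section

variable {K : Type*} [Field K] {n : ℕ}

/-- The degree `i` graded piece of the standard graded algebra `R/I`,
where `R = K[x_1,…,x_n]`. -/
def piece (I : Ideal (MvPolynomial (Fin n) K)) (i : ℕ) :
    Submodule K (MvPolynomial (Fin n) K ⧸ I) :=
  (homogeneousSubmodule (Fin n) K i).map (Ideal.Quotient.mkₐ K I).toLinearMap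

/-- The Hilbert function of the standard graded algebra `R/I`. -/
def hf (I : Ideal (MvPolynomial (Fin n) K)) (i : ℕ) : ℕ :=
  Module.finrank K (piece I i)

/-- `I` is a homogeneous ideal. -/
def IsHomogIdeal (I : Ideal (MvPolynomial (Fin n) K)) : Prop :=
  ∀ p ∈ I, ∀ i : ℕ, homogeneousComponent i p ∈ I

/-- The socle of `R/I`: the annihilator of the irrelevant maximal ideal. -/
def socle (I : Ideal (MvPolynomial (Fin n) K)) :
    Submodule K (MvPolynomial (Fin n) K ⧸ I) :=
  ⨅ j : Fin n, LinearMap.ker (LinearMap.mulLeft K (Ideal.Quotient.mk I (X j)))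

/-- `R/I` is a standard graded artinian Gorenstein algebra of socle degree `d`:
`I` is homogeneous, the Hilbert function vanishes above degree `d`, is symmetric,
and the socle is one-dimensional, concentrated in degree `d`. -/
def IsArtinianGorenstein (I : Ideal (MvPolynomial (Fin n) K)) (d : ℕ) : Prop :=
  IsHomogIdeal I ∧ hf I d = 1 ∧ (∀ i : ℕ, d < i → hf I i = 0) ∧
    (∀ i : ℕ, i ≤ d → hf I i = hf I (d - i)) ∧
    Module.finrank K (socle I) = 1 ∧ socle I ≤ piece I d

/-- The weak Lefschetz property for `R/I`: there is a linear form `ℓ` such that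
multiplication `×ℓ : [A]_i → [A]_{i+1}` has maximal rank (is injective or
surjective) for every `i`. -/
def WLP (I : Ideal (MvPolynomial (Fin n) K)) : Prop :=
  ∃ ℓ : MvPolynomial (Fin n) K, ℓ.IsHomogeneous 1 ∧ ∀ i : ℕ,
    (∀ a ∈ piece I i, Ideal.Quotient.mk I ℓ * a = 0 → a = 0) ∨
    (∀ b ∈ piece I (i + 1), ∃ a ∈ piece I i, Ideal.Quotient.mk I ℓ * a = b)

/-- The strong Lefschetz property for `R/I`: there is a linear form `ℓ` such that
`×ℓ^k : [A]_i → [A]_{i+k}` has maximal rank for all `i ≥ 0`, `k ≥ 1`. -/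
def SLP (I : Ideal (MvPolynomial (Fin n) K)) : Prop :=
  ∃ ℓ : MvPolynomial (Fin n) K, ℓ.IsHomogeneous 1 ∧ ∀ i k : ℕ, 1 ≤ k →
    ((∀ a ∈ piece I i, Ideal.Quotient.mk I ℓ ^ k * a = 0 → a = 0) ∨
     (∀ b ∈ piece I (i + k), ∃ a ∈ piece I i, Ideal.Quotient.mk I ℓ ^ k * a = b))

/-- The action of `p ∈ R = K[x_1,…,x_n]` on `S = K[X_1,…,X_n]` by differentiation,
`x_i` acting as `∂/∂X_i`. -/
def diffOp (p : MvPolynomial (Fin n) K) :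
    Module.End K (MvPolynomial (Fin n) K) :=
  ∑ m ∈ p.support, MvPolynomial.coeff m p •
    (List.ofFn fun j : Fin n =>
      ((pderiv j).toLinearMap : Module.End K (MvPolynomial (Fin n) K)) ^ (m j)).prod

/-- The degree-`d` graded piece of the inverse system `I^⊥ = {F : g ∘ F = 0 ∀ g ∈ I}`. -/
def invSys (I : Ideal (MvPolynomial (Fin n) K)) (d : ℕ) :
    Submodule K (MvPolynomial (Fin n) K) :=
  homogeneousSubmodule (Fin n) K d ⊓ ⨅ g ∈ I, LinearMap.ker (diffOp g)

end

section Part1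
section PolyFun
variable {K : Type*} [Field K] {T : Type*} {F : Type*} [AddCommGroup F] [Module K F]

/-- Vector valued functions whose scalar components lie in a given algebra of functions. -/
def VPF (Q : Subalgebra K (T → K)) (y : T → F) : Prop :=
  ∀ ψ : F →ₗ[K] K, (fun t => ψ (y t)) ∈ Q

lemma VPF.add {Q : Subalgebra K (T → K)} {y z : T → F} (hy : VPF Q y) (hz : VPF Q z) :
    VPF Q (fun t => y t + z t) := by
  intro ψ
  have := Q.add_mem (hy ψ) (hz ψ)
  convert this using 1
  funext t; simp

lemma VPF.smul {Q : Subalgebra K (T → K)} {f : T → K} {y : T → F} (hf : f ∈ Q) (hy : VPF Q y) :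
    VPF Q (fun t => f t • y t) := by
  intro ψ
  have := Q.mul_mem hf (hy ψ)
  convert this using 1
  funext t; simp

lemma VPF.const (Q : Subalgebra K (T → K)) (y : F) : VPF Q (fun _ : T => y) := by
  intro ψ
  exact Q.algebraMap_mem (ψ y)

lemma VPF.sum {Q : Subalgebra K (T → K)} {ι : Type*} (s : Finset ι) {y : ι → T → F}
    (hy : ∀ i ∈ s, VPF Q (y i)) : VPF Q (fun t => ∑ i ∈ s, y i t) := by
  intro ψ
  have := Q.sum_mem (fun i hi => hy i hi ψ)
  convert this using 1
  funext t; simp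

lemma VPF.indep {Q : Subalgebra K (T → K)} {ι : Type*} [Fintype ι] {v : ι → T → F}
    (hv : ∀ i, VPF Q (v i)) (t₀ : T) (h : LinearIndependent K (fun i => v i t₀)) :
    ∃ f ∈ Q, f t₀ ≠ 0 ∧ ∀ t, f t ≠ 0 → LinearIndependent K (fun i => v i t) := by
  classical
  have hinj : LinearMap.ker (Fintype.linearCombination K (fun i => v i t₀)) = ⊥ :=
    LinearMap.ker_eq_bot.2 (linearIndependent_iff_injective_fintypeLinearCombination.1 h)
  obtain ⟨g, hg⟩ := LinearMap.exists_leftInverse_of_injective _ hinj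
  refine ⟨fun t => (Matrix.of fun i j => g (v j t) i).det, ?_, ?_, ?_⟩
  · have : (fun t => (Matrix.of fun i j => g (v j t) i).det) =
        ∑ σ : Equiv.Perm ι, (Equiv.Perm.sign σ : ℤ) • ∏ i, fun t => g (v i t) (σ i) := by
      funext t
      simp [Matrix.det_apply', Finset.sum_apply, Finset.prod_apply]
    rw [this]
    refine Q.sum_mem fun σ _ => Q.zsmul_mem (Q.prod_mem fun i _ => ?_) _
    exact hv i (LinearMap.proj (σ i) ∘ₗ g)
  · have : (Matrix.of fun i j => g (v j t₀) i) = 1 := by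
      ext i j
      have h1 := LinearMap.congr_fun hg (Pi.single j 1)
      simp at h1
      simp [h1, Matrix.one_apply, Pi.single_apply]
    simp [this]
  · intro t ht
    rw [Fintype.linearIndependent_iff]
    intro c hc
    have h2 : (Matrix.of fun i j => g (v j t) i).mulVec c = 0 := by
      funext i
      have := congrFun (congrArg g hc) i
      simp only [map_sum, map_smul, map_zero] at this
      simp only [Matrix.mulVec, dotProduct, Matrix.of_apply, Pi.zero_apply]
      simpa [Finset.sum_apply, mul_comm] using this
    exact fun i => congrFun (Matrix.eq_zero_of_mulVec_eq_zero ht h2) i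

/-- polynomial functions of one variable -/
noncomputable def PF1 (K : Type*) [Field K] : Subalgebra K (K → K) :=
  (Polynomial.aeval (R := K) (id : K → K)).range

/-- polynomial functions of three variables -/
noncomputable def PF3 (K : Type*) [Field K] : Subalgebra K ((Fin 3 → K) → K) :=
  (MvPolynomial.aeval (R := K) (fun (i : Fin 3) (u : Fin 3 → K) => u i)).range

lemma id_mem_PF1 : (fun t : K => t) ∈ PF1 K := ⟨Polynomial.X, by simp; rfl⟩

lemma proj_mem_PF3 (i : Fin 3) : (fun u : Fin 3 → K => u i) ∈ PF3 K := ⟨MvPolynomial.X i, by simp⟩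

lemma mem_PF1_iff {f : K → K} : f ∈ PF1 K ↔ ∃ p : Polynomial K, ∀ t, f t = p.eval t := by
  have key : ∀ (p : Polynomial K) (t : K), (Polynomial.aeval (R := K) (id : K → K) p) t = p.eval t := by
    intro p t
    rw [Polynomial.aeval_fn_apply]
    simp
  constructor
  · rintro ⟨p, rfl⟩
    exact ⟨p, key p⟩
  · rintro ⟨p, hp⟩
    exact ⟨p, funext fun t => (key p t).trans (hp t).symm⟩

lemma mem_PF3_iff {f : (Fin 3 → K) → K} :
    f ∈ PF3 K ↔ ∃ p : MvPolynomial (Fin 3) K, ∀ t, f t = MvPolynomial.eval t p := by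
  have key : ∀ (p : MvPolynomial (Fin 3) K) (t : Fin 3 → K),
      (MvPolynomial.aeval (R := K) (fun (i : Fin 3) (u : Fin 3 → K) => u i) p) t
        = MvPolynomial.eval t p := by
    intro p t
    induction p using MvPolynomial.induction_on with
    | C a => simp
    | add p q hp hq => simp [hp, hq]
    | mul_X p i hp => simp [hp]
  constructor
  · rintro ⟨p, rfl⟩
    exact ⟨p, key p⟩
  · rintro ⟨p, hp⟩
    exact ⟨p, funext fun t => (key p t).trans (hp t).symm⟩

lemma PF1.exists_ne [Infinite K] {f : K → K} (hf : f ∈ PF1 K) {t₀ : K} (h : f t₀ ≠ 0) :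
    ∃ t, t ≠ 0 ∧ f t ≠ 0 := by
  obtain ⟨p, hp⟩ := mem_PF1_iff.1 hf
  have h0 : p ≠ 0 := by rintro rfl; simp [hp] at h
  have h1 : p * Polynomial.X ≠ 0 := mul_ne_zero h0 Polynomial.X_ne_zero
  by_contra! hcon
  apply h1
  apply Polynomial.funext
  intro t
  by_cases ht : t = 0
  · simp [ht]
  · simp [← hp, hcon t ht]

/-- a generic property of points of `K^3` -/
def Gen (S : (Fin 3 → K) → Prop) : Prop :=
  ∃ p : MvPolynomial (Fin 3) K, p ≠ 0 ∧ ∀ u, MvPolynomial.eval u p ≠ 0 → S u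

lemma Gen.and {S S' : (Fin 3 → K) → Prop} (h : Gen S) (h' : Gen S') : Gen (fun u => S u ∧ S' u) := by
  obtain ⟨p, hp, hS⟩ := h
  obtain ⟨q, hq, hS'⟩ := h'
  refine ⟨p * q, mul_ne_zero hp hq, fun u hu => ?_⟩
  rw [map_mul] at hu
  exact ⟨hS u (left_ne_zero_of_mul hu), hS' u (right_ne_zero_of_mul hu)⟩

lemma Gen.true : Gen (fun _ : Fin 3 → K => True) := ⟨1, one_ne_zero, fun _ _ => trivial⟩

lemma Gen.ball {ι : Type*} (s : Finset ι) {S : ι → (Fin 3 → K) → Prop} (h : ∀ i ∈ s, Gen (S i)) :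
    Gen (fun u => ∀ i ∈ s, S i u) := by
  classical
  induction s using Finset.induction_on with
  | empty => exact ⟨1, one_ne_zero, fun _ _ => by simp⟩
  | insert a s ha ih =>
    have h1 := (h a (by simp)).and (ih fun i hi => h i (by simp [hi]))
    obtain ⟨p, hp, hS⟩ := h1
    refine ⟨p, hp, fun u hu i hi => ?_⟩
    rcases Finset.mem_insert.1 hi with rfl | hi
    · exact (hS u hu).1
    · exact (hS u hu).2 i hi

lemma Gen.exists [Infinite K] {S : (Fin 3 → K) → Prop} (h : Gen S) : ∃ u, S u := by
  obtain ⟨p, hp, hS⟩ := h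
  by_contra! hcon
  apply hp
  apply MvPolynomial.funext
  intro u
  by_contra hu
  exact hcon u (hS u (by simpa using hu))

lemma Gen.of_PF3 {f : (Fin 3 → K) → K} (hf : f ∈ PF3 K) {u₀ : Fin 3 → K} (h : f u₀ ≠ 0) :
    Gen (fun u => f u ≠ 0) := by
  obtain ⟨p, hp⟩ := mem_PF3_iff.1 hf
  refine ⟨p, ?_, fun u hu => by
    show f u ≠ 0
    rwa [hp]⟩
  rintro rfl
  simp [hp] at h

lemma Gen.mono {S S' : (Fin 3 → K) → Prop} (h : Gen S) (hh : ∀ u, S u → S' u) : Gen S' := by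
  obtain ⟨p, hp, hS⟩ := h
  exact ⟨p, hp, fun u hu => hh u (hS u hu)⟩

lemma Gen.notMem_submodule (U : Submodule K (Fin 3 → K)) (hU : U ≠ ⊤) : Gen (fun u => u ∉ U) := by
  obtain ⟨u₀, hu₀⟩ : ∃ u₀, u₀ ∉ U := by
    by_contra! h
    exact hU (Submodule.eq_top_iff'.2 h)
  obtain ⟨φ, hφ, hφU⟩ := Submodule.exists_le_ker_of_notMem hu₀
  have hmem : (fun u => φ u) ∈ PF3 K := by
    have : (fun u => φ u) = ∑ i : Fin 3, φ (Pi.single i 1) • (fun u : Fin 3 → K => u i) := by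
      funext u
      conv_lhs => rw [← Finset.univ_sum_single u]
      rw [map_sum, Finset.sum_apply]
      refine Finset.sum_congr rfl fun i _ => ?_
      rw [show (Pi.single i (u i) : Fin 3 → K) = u i • Pi.single i 1 by
        rw [← Pi.single_smul]; simp]
      simp [mul_comm]
    rw [this]
    exact Subalgebra.sum_mem _ fun i _ => Subalgebra.smul_mem _ (proj_mem_PF3 i) _
  refine (Gen.of_PF3 hmem hφ).mono fun u hu hmem => hu (hφU hmem)

end PolyFun

section Rank
variable {K : Type*} [Field K] {A : Type*} [CommRing A] [Algebra K A]

/-- the subspace `a * S` -/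
def mm (a : A) (S : Submodule K A) : Submodule K A := S.map (LinearMap.mulLeft K a)

lemma mem_mm {a b : A} {S : Submodule K A} : b ∈ mm a S ↔ ∃ s ∈ S, a * s = b := by
  simp [mm]

lemma mul_mem_mm {a s : A} {S : Submodule K A} (h : s ∈ S) : a * s ∈ mm a S := mem_mm.2 ⟨s, h, rfl⟩

instance mm_fd (a : A) (S : Submodule K A) [FiniteDimensional K S] : FiniteDimensional K (mm a S) := by
  unfold mm; infer_instance

/-- semicontinuity of rank -/
lemma rank_semicont {T : Type*} {Q : Subalgebra K (T → K)} (S : Submodule K A)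
    [FiniteDimensional K S] (g : T → A) (hg : ∀ s ∈ S, VPF Q (fun t => g t * s)) (t₀ : T) :
    ∃ f ∈ Q, f t₀ ≠ 0 ∧ ∀ t, f t ≠ 0 →
      Module.finrank K (mm (g t₀) S) ≤ Module.finrank K (mm (g t) S) := by
  let b := Module.finBasis K (mm (g t₀) S)
  have hb : ∀ i, ∃ s ∈ S, g t₀ * s = b i := fun i => mem_mm.1 (b i).2
  choose s hs hsb using hb
  have hli : LinearIndependent K (fun i => g t₀ * s i) := by
    have : (fun i => g t₀ * s i) = (mm (g t₀) S).subtype ∘ b := by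
      funext i; simp [hsb]
    rw [this]
    exact b.linearIndependent.map' _ (Submodule.ker_subtype _)
  obtain ⟨f, hf, hf0, h⟩ := VPF.indep (v := fun i t => g t * s i) (fun i => hg _ (hs i)) t₀ hli
  refine ⟨f, hf, hf0, fun t ht => ?_⟩
  have h1 := h t ht
  have h2 : LinearIndependent K
      (fun i => (⟨g t * s i, mul_mem_mm (hs i)⟩ : mm (g t) S)) :=
    LinearIndependent.of_comp (mm (g t) S).subtype h1
  simpa using h2.fintype_card_le_finrank

/-- limits of images -/
lemma closed_image [Infinite K] (S : Submodule K A) [FiniteDimensional K S] (g : K → A)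
    (hg : ∀ s ∈ S, VPF (PF1 K) (fun t => g t * s)) (y : K → A) (hy : VPF (PF1 K) y)
    (hym : ∀ t, t ≠ 0 → y t ∈ mm (g t) S)
    (hr : ∀ t, Module.finrank K (mm (g t) S) ≤ Module.finrank K (mm (g 0) S)) :
    y 0 ∈ mm (g 0) S := by
  by_contra hcon
  let b := Module.finBasis K (mm (g 0) S)
  have hb : ∀ i, ∃ s ∈ S, g 0 * s = b i := fun i => mem_mm.1 (b i).2
  choose s hs hsb using hb
  have hli : LinearIndependent K (fun i => g 0 * s i) := by
    have : (fun i => g 0 * s i) = (mm (g 0) S).subtype ∘ b := by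
      funext i; simp [hsb]
    rw [this]
    exact b.linearIndependent.map' _ (Submodule.ker_subtype _)
  have hspan : y 0 ∉ Submodule.span K (Set.range fun i => g 0 * s i) := by
    intro h
    apply hcon
    refine Submodule.span_le.2 ?_ h
    rintro _ ⟨i, rfl⟩
    exact mul_mem_mm (hs i)
  have hli' := hli.option (x := y 0) hspan
  let v : Option (Fin (Module.finrank K (mm (g 0) S))) → K → A :=
    fun o t => o.elim (y t) (fun i => g t * s i)
  have hv : ∀ o, VPF (PF1 K) (v o) := by
    rintro (_ | i)
    · exact hy
    · exact hg _ (hs i)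
  have hli'' : LinearIndependent K (fun o => v o 0) := by
    have h0 : (fun o => v o 0) = fun o => o.casesOn' (y 0) (fun i => g 0 * s i) := by
      funext o
      cases o <;> rfl
    rw [h0]
    exact hli'
  obtain ⟨f, hf, hf0, h⟩ := VPF.indep hv 0 hli''
  obtain ⟨t, ht, hft⟩ := PF1.exists_ne hf hf0
  have h1 := h t hft
  have hmem : ∀ o, v o t ∈ mm (g t) S := by
    rintro (_ | i)
    · exact hym t ht
    · exact mul_mem_mm (hs i)
  have h2 : LinearIndependent K (fun o => (⟨v o t, hmem o⟩ : mm (g t) S)) :=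
    LinearIndependent.of_comp (mm (g t) S).subtype h1
  have h3 := h2.fintype_card_le_finrank
  have h4 := hr t
  simp at h3
  omega

end Rank
end Part1

section Part2
section LinAlg
variable {K : Type*} [Field K] {E F : Type*} [AddCommGroup E] [Module K E] [AddCommGroup F] [Module K F]
open Module

lemma rank_nullity (f : E →ₗ[K] F) (D : Submodule K E) [FiniteDimensional K D] :
    finrank K (D.map f) + finrank K (D ⊓ LinearMap.ker f : Submodule K E) = finrank K D := by
  have h := LinearMap.finrank_range_add_finrank_ker (f.domRestrict D)
  rw [LinearMap.range_domRestrict, LinearMap.ker_domRestrict] at h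
  rw [← h]
  congr 1
  rw [← Submodule.map_comap_subtype]
  exact (LinearEquiv.finrank_eq (Submodule.equivMapOfInjective D.subtype D.injective_subtype _)).symm

lemma map_inf_comap' (f : E →ₗ[K] F) (D : Submodule K E) (S : Submodule K F) :
    (D ⊓ S.comap f).map f = D.map f ⊓ S := by
  ext y
  simp only [Submodule.mem_map, Submodule.mem_inf, Submodule.mem_comap]
  constructor
  · rintro ⟨z, ⟨h1, h2⟩, rfl⟩
    exact ⟨⟨z, h1, rfl⟩, h2⟩
  · rintro ⟨⟨z, h1, rfl⟩, h2⟩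
    exact ⟨z, ⟨h1, h2⟩, rfl⟩

lemma quot_aux (f : E →ₗ[K] F) (D : Submodule K E) [FiniteDimensional K D] (S : Submodule K F)
    [FiniteDimensional K S] :
    finrank K (S ⊔ D.map f : Submodule K F) + finrank K (D ⊓ S.comap f : Submodule K E)
      = finrank K S + finrank K D := by
  have h1 := rank_nullity f D
  have : FiniteDimensional K (D ⊓ S.comap f : Submodule K E) :=
    Submodule.finiteDimensional_of_le (inf_le_left : _ ≤ D)
  have h2 := rank_nullity f (D ⊓ S.comap f)
  rw [map_inf_comap'] at h2
  have h3 : (D ⊓ S.comap f) ⊓ LinearMap.ker f = D ⊓ LinearMap.ker f := by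
    ext y
    simp only [Submodule.mem_inf, Submodule.mem_comap, LinearMap.mem_ker]
    constructor
    · rintro ⟨⟨h1, _⟩, h⟩; exact ⟨h1, h⟩
    · rintro ⟨h1, h⟩; exact ⟨⟨h1, by rw [h]; exact S.zero_mem⟩, h⟩
  rw [h3] at h2
  have h4 := Submodule.finrank_sup_add_finrank_inf_eq S (D.map f)
  rw [inf_comm] at h4
  omega

lemma finrank_mono' {S T : Submodule K F} [FiniteDimensional K T] (h : S ≤ T) :
    finrank K S ≤ finrank K T := Submodule.finrank_mono h

lemma polyV (n : ℕ) (V : Submodule K (Polynomial K)) (hV : V ≤ Polynomial.degreeLT K n)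
    [FiniteDimensional K V] (h0 : V ≠ ⊥) :
    finrank K V + 1 ≤ finrank K
      (V ⊔ V.map (LinearMap.mulLeft K (Polynomial.X : Polynomial K)) : Submodule K (Polynomial K)) := by
  apply Submodule.finrank_lt_finrank_of_lt
  refine lt_of_le_of_ne le_sup_left fun heq => ?_
  have hX : ∀ p ∈ V, Polynomial.X * p ∈ V := by
    intro p hp
    rw [heq]
    exact Submodule.mem_sup_right ⟨p, hp, rfl⟩
  obtain ⟨p, hp, hp0⟩ := Submodule.exists_mem_ne_zero_of_ne_bot h0
  have hk : ∀ k : ℕ, Polynomial.X ^ k * p ∈ V := by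
    intro k
    induction k with
    | zero => simpa using hp
    | succ k ih =>
      rw [pow_succ', mul_assoc]
      exact hX _ ih
  have h1 := Polynomial.mem_degreeLT.1 (hV (hk n))
  have h2 : Polynomial.X ^ n * p ≠ 0 := mul_ne_zero (pow_ne_zero _ Polynomial.X_ne_zero) hp0
  rw [Polynomial.degree_eq_natDegree h2, Polynomial.natDegree_X_pow_mul _ hp0] at h1
  have h3 : p.natDegree + n < n := by exact_mod_cast h1
  omega
end LinAlg
end Part2

section Part3
open Module
section Graded
variable {K : Type*} [Field K] {A : Type*} [CommRing A] [Algebra K A]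

/-- abstract form of the graded algebras under consideration -/
structure GA (P : ℕ → Submodule K A) (x : Fin 3 → A) (m : ℕ) : Prop where
  hm : 2 ≤ m
  fd : ∀ i, FiniteDimensional K (P i)
  one : P 0 = Submodule.span K {1}
  succ : ∀ i, P (i + 1) = ⨆ j, mm (x j) (P i)
  mul : ∀ i j a b, a ∈ P i → b ∈ P j → a * b ∈ P (i + j)
  nd : ∀ i, i < 2 * m + 1 → ∀ a ∈ P i, (∀ j, x j * a = 0) → a = 0
  ftop : finrank K (P (2 * m + 1)) = 1
  sym : ∀ i, i ≤ 2 * m + 1 → finrank K (P i) = finrank K (P (2 * m + 1 - i))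
  f0 : finrank K (P 0) = 1
  f1 : finrank K (P 1) = 3
  fi : ∀ i, 2 ≤ i → i ≤ m → finrank K (P i) = 2 * i + 2
  fmid : finrank K (P (m + 1)) = 2 * m + 2

/-- linear forms -/
def LL (K : Type*) [Field K] {A : Type*} [CommRing A] [Algebra K A] (x : Fin 3 → A) :
    (Fin 3 → K) →ₗ[K] A := Fintype.linearCombination K x

lemma LL_apply (x : Fin 3 → A) (u : Fin 3 → K) : LL K x u = ∑ i, u i • x i := by
  simp [LL, Fintype.linearCombination_apply]

lemma LL_single (x : Fin 3 → A) (i : Fin 3) : LL K x (Pi.single i 1) = x i := by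
  simp [LL]

variable {P : ℕ → Submodule K A} {x : Fin 3 → A} {m : ℕ}

namespace GA

lemma one_mem (G : GA P x m) : (1 : A) ∈ P 0 := by
  rw [G.one]; exact Submodule.mem_span_singleton_self 1

lemma x_mem (G : GA P x m) (i : Fin 3) : x i ∈ P 1 := by
  rw [G.succ 0]
  refine Submodule.mem_iSup_of_mem i ?_
  simpa using mul_mem_mm (a := x i) G.one_mem

lemma L_mem (G : GA P x m) (u : Fin 3 → K) : LL K x u ∈ P 1 := by
  rw [LL_apply]
  exact Submodule.sum_mem _ fun i _ => Submodule.smul_mem _ _ (G.x_mem i)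

lemma P1_eq (G : GA P x m) : P 1 = LinearMap.range (LL K x) := by
  apply le_antisymm
  · rw [G.succ 0]
    refine iSup_le fun j => ?_
    intro b hb
    obtain ⟨s, hs, rfl⟩ := mem_mm.1 hb
    rw [G.one] at hs
    obtain ⟨c, rfl⟩ := Submodule.mem_span_singleton.1 hs
    refine ⟨c • Pi.single j 1, ?_⟩
    rw [map_smul, LL_single]
    simp
  · rintro _ ⟨u, rfl⟩
    exact G.L_mem u

lemma L_inj (G : GA P x m) : Function.Injective (LL K x) := by
  rw [← LinearMap.ker_eq_bot]
  have h := LinearMap.finrank_range_add_finrank_ker (LL K x)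
  rw [← G.P1_eq, G.f1] at h
  simp at h
  exact h

lemma nd' (G : GA P x m) {i : ℕ} (hi : i < 2 * m + 1) {a : A} (ha : a ∈ P i) (h : ∀ v, LL K x v * a = 0) : a = 0 :=
  G.nd i hi a ha fun j => by rw [← LL_single (K := K) x]; exact h _

lemma Lmul_mem (G : GA P x m) (u : Fin 3 → K) {i : ℕ} {a : A} (ha : a ∈ P i) : LL K x u * a ∈ P (i + 1) := by
  rw [add_comm]; exact G.mul _ _ _ _ (G.L_mem u) ha

lemma Lpow_mem (G : GA P x m) (u : Fin 3 → K) (n : ℕ) {i : ℕ} {a : A} (ha : a ∈ P i) :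
    LL K x u ^ n * a ∈ P (i + n) := by
  induction n with
  | zero => simpa using ha
  | succ n ih =>
    rw [pow_succ', mul_assoc]
    exact G.Lmul_mem u ih

lemma mm_L_le (G : GA P x m) (u : Fin 3 → K) (i : ℕ) : mm (LL K x u) (P i) ≤ P (i + 1) := by
  intro b hb
  obtain ⟨s, hs, rfl⟩ := mem_mm.1 hb
  exact G.Lmul_mem u hs

lemma succ_le (G : GA P x m) (i : ℕ) (S : Submodule K A) (h : ∀ v, ∀ b ∈ P i, LL K x v * b ∈ S) : P (i + 1) ≤ S := by
  rw [G.succ]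
  refine iSup_le fun j => ?_
  intro b hb
  obtain ⟨s, hs, rfl⟩ := mem_mm.1 hb
  rw [← LL_single (K := K) x]; exact h _ _ hs

lemma exists_basis (u : Fin 3 → K) (hu : u ≠ 0) : ∃ w₁ w₂ : Fin 3 → K, ∀ v, ∃ α β γ : K,
    v = α • u + β • w₁ + γ • w₂ := by
  have hli : LinearIndependent K (fun _ : Fin 1 => u) := by
    rw [linearIndependent_unique_iff]; exact hu
  obtain ⟨s, t, hst, hspan⟩ : ∃ w₁ w₂ : Fin 3 → K, True ∧
      Submodule.span K {u, w₁, w₂} = ⊤ := by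
    obtain ⟨C, hC⟩ := Submodule.exists_isCompl (Submodule.span K {u})
    have hf := Submodule.finrank_add_eq_of_isCompl hC
    rw [finrank_span_singleton hu] at hf
    have hC2 : finrank K C = 2 := by simp at hf; omega
    let b := Module.finBasisOfFinrankEq K C hC2
    refine ⟨b 0, b 1, trivial, ?_⟩
    rw [Submodule.span_insert, ← hC.sup_eq_top]
    congr 1
    have := congrArg (Submodule.map C.subtype) b.span_eq
    rw [Submodule.map_span] at this
    simp at this
    refine Eq.trans ?_ this
    congr 1
    ext y
    simp only [Set.mem_insert_iff, Set.mem_singleton_iff, Set.mem_image, Set.mem_range]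
    constructor
    · rintro (rfl | rfl)
      · exact ⟨_, ⟨0, rfl⟩, rfl⟩
      · exact ⟨_, ⟨1, rfl⟩, rfl⟩
    · rintro ⟨_, ⟨i, rfl⟩, rfl⟩
      fin_cases i
      · left; rfl
      · right; rfl
  refine ⟨s, t, fun v => ?_⟩
  have : v ∈ Submodule.span K {u, s, t} := by rw [hspan]; trivial
  obtain ⟨a, b, c, h⟩ := Submodule.mem_span_triple.1 this
  exact ⟨a, b, c, h.symm⟩

/-- homogenized evaluation of polynomials at `s, t` -/
noncomputable def Th (s t : A) (j : ℕ) : Polynomial K →ₗ[K] A :=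
  ∑ k ∈ Finset.range (j + 1), (Polynomial.lcoeff K k).smulRight (t ^ k * s ^ (j - k))

lemma Th_apply (s t : A) (j : ℕ) (p : Polynomial K) :
    Th s t j p = ∑ k ∈ Finset.range (j + 1), p.coeff k • (t ^ k * s ^ (j - k)) := by
  simp [Th, LinearMap.sum_apply]

lemma Th_s (s t : A) (j : ℕ) (p : Polynomial K) (hp : p ∈ Polynomial.degreeLT K (j + 1)) :
    s * Th s t j p = Th s t (j + 1) p := by
  have h0 : p.coeff (j + 1) = 0 :=
    Polynomial.coeff_eq_zero_of_degree_lt (Polynomial.mem_degreeLT.1 hp)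
  rw [Th_apply, Th_apply, Finset.sum_range_succ _ (j + 1), h0, zero_smul, add_zero, Finset.mul_sum]
  refine Finset.sum_congr rfl fun k hk => ?_
  have hk' : k ≤ j := by simp at hk; omega
  rw [show j + 1 - k = (j - k) + 1 by omega, pow_succ, mul_smul_comm]
  congr 1
  ring

lemma Th_t (s t : A) (j : ℕ) (p : Polynomial K) :
    t * Th s t j p = Th s t (j + 1) (Polynomial.X * p) := by
  rw [Th_apply, Th_apply, Finset.sum_range_succ' _ (j + 1), Finset.mul_sum]
  simp only [Polynomial.coeff_X_mul, Polynomial.coeff_X_mul_zero, zero_smul, add_zero]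
  refine Finset.sum_congr rfl fun k hk => ?_
  rw [show j + 1 - (k + 1) = j - k by omega, pow_succ, mul_smul_comm]
  congr 1
  ring

lemma X_mul_mem {n : ℕ} {p : Polynomial K} (hp : p ∈ Polynomial.degreeLT K n) :
    Polynomial.X * p ∈ Polynomial.degreeLT K (n + 1) := by
  rw [Polynomial.mem_degreeLT] at hp ⊢
  by_cases hp0 : p = 0
  · rw [hp0, mul_zero, Polynomial.degree_zero]; exact WithBot.bot_lt_coe _
  · rw [Polynomial.degree_eq_natDegree hp0] at hp
    rw [Polynomial.degree_eq_natDegree (mul_ne_zero Polynomial.X_ne_zero hp0),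
      Polynomial.natDegree_X_mul hp0]
    have h : p.natDegree < n := by exact_mod_cast hp
    exact_mod_cast (by omega : p.natDegree + 1 < n + 1)

lemma P_le (G : GA P x m) (u : Fin 3 → K) {w₁ w₂ : Fin 3 → K}
    (hw : ∀ v, ∃ α β γ : K, v = α • u + β • w₁ + γ • w₂) (j : ℕ) :
    P (j + 1) ≤ mm (LL K x u) (P j) ⊔
      (Polynomial.degreeLT K (j + 2)).map (Th (LL K x w₁) (LL K x w₂) (j + 1)) := by
  have key : ∀ (j : ℕ) (E : Submodule K A), E ≤ P j →
      P j ≤ E ⊔ (Polynomial.degreeLT K (j + 1)).map (Th (LL K x w₁) (LL K x w₂) j) →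
      (∀ v, ∀ b ∈ E, LL K x v * b ∈ mm (LL K x u) (P j)) →
      P (j + 1) ≤ mm (LL K x u) (P j) ⊔
      (Polynomial.degreeLT K (j + 2)).map (Th (LL K x w₁) (LL K x w₂) (j + 1)) := by
    intro j E hE hP hEm
    refine G.succ_le _ _ fun v b hb => ?_
    obtain ⟨α, β, γ, rfl⟩ := hw v
    obtain ⟨e, he, f, hf, rfl⟩ := Submodule.mem_sup.1 (hP hb)
    obtain ⟨p, hp, rfl⟩ := hf
    rw [mul_add]
    refine Submodule.add_mem _ (Submodule.mem_sup_left (hEm _ _ he)) ?_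
    rw [map_add, map_add, map_smul, map_smul, map_smul, add_mul, add_mul, smul_mul_assoc,
      smul_mul_assoc, smul_mul_assoc, Th_s _ _ _ _ hp, Th_t]
    refine Submodule.add_mem _ (Submodule.add_mem _ ?_ ?_) ?_
    · refine Submodule.smul_mem _ _ (Submodule.mem_sup_left (mul_mem_mm ?_))
      have := (Submodule.add_mem_iff_right _ (hE he)).1 hb
      exact this
    · refine Submodule.smul_mem _ _ (Submodule.mem_sup_right ⟨p, ?_, rfl⟩)
      exact Polynomial.degreeLT_mono (by omega) hp
    · refine Submodule.smul_mem _ _ (Submodule.mem_sup_right ⟨_, ?_, rfl⟩)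
      exact X_mul_mem hp
  induction j with
  | zero =>
    refine key 0 ⊥ bot_le ?_ ?_
    · rw [G.one, Submodule.span_le]
      intro y hy
      rw [Set.mem_singleton_iff] at hy
      subst hy
      refine Submodule.mem_sup_right ⟨1, ?_, ?_⟩
      · rw [SetLike.mem_coe, Polynomial.mem_degreeLT]
        simp
      · rw [Th_apply]; simp
    · intro v b hb
      rw [Submodule.mem_bot] at hb
      subst hb
      simp
  | succ j ih =>
    refine key (j + 1) _ (G.mm_L_le u j) ih ?_
    intro v b hb
    obtain ⟨s, hs, rfl⟩ := mem_mm.1 hb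
    rw [mul_left_comm]
    exact mul_mem_mm (G.Lmul_mem v hs)

lemma finrank_degreeLT (n : ℕ) : finrank K (Polynomial.degreeLT K n) = n := by
  rw [LinearEquiv.finrank_eq (Polynomial.degreeLTEquiv K n)]; simp

lemma fd_degreeLT (n : ℕ) : FiniteDimensional K (Polynomial.degreeLT K n) :=
  (Polynomial.degreeLTEquiv K n).symm.finiteDimensional

lemma mm_fd' (G : GA P x m) (a : A) (j : ℕ) : FiniteDimensional K (mm a (P j)) := by
  have := G.fd j
  infer_instance

lemma Ldd (G : GA P x m) (u : Fin 3 → K) (hu : u ≠ 0) (j : ℕ) :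
    finrank K (P (j + 1)) ≤ finrank K (mm (LL K x u) (P j)) + (j + 2) := by
  obtain ⟨w₁, w₂, hw⟩ := exists_basis u hu
  have hP := G.P_le u hw j
  have := G.mm_fd' (LL K x u) j
  have := fd_degreeLT (K := K) (j + 2)
  have h := quot_aux (Th (LL K x w₁) (LL K x w₂) (j + 1)) (Polynomial.degreeLT K (j + 2))
    (mm (LL K x u) (P j))
  have h2 := Submodule.finrank_mono hP
  rw [finrank_degreeLT] at h
  omega

lemma Ld (G : GA P x m) (u : Fin 3 → K) (hu : u ≠ 0) (j : ℕ) (B C : Submodule K A) (hB : B ≤ P (j + 1))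
    (hd : finrank K (P (j + 1)) ≤ finrank K B + (j + 1))
    (hC' : mm (LL K x u) (P (j + 1)) ≤ C) (hC : C ≤ P (j + 2))
    (hBC : ∀ v, ∀ b ∈ B, LL K x v * b ∈ C) :
    finrank K (P (j + 2)) + finrank K B ≤ finrank K C + finrank K (P (j + 1)) := by
  obtain ⟨w₁, w₂, hw⟩ := exists_basis u hu
  have i1 := G.fd (j + 1)
  have i2 := G.fd (j + 2)
  have i3 : FiniteDimensional K B := Submodule.finiteDimensional_of_le hB
  have i4 : FiniteDimensional K C := Submodule.finiteDimensional_of_le hC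
  have i5 := fd_degreeLT (K := K) (j + 2)
  have i6 := fd_degreeLT (K := K) (j + 3)
  have hTh : ∀ (i : ℕ) (p : Polynomial K), Th (LL K x w₁) (LL K x w₂) i p ∈ P i := by
    intro i p
    rw [Th_apply]
    refine Submodule.sum_mem _ fun k hk => Submodule.smul_mem _ _ ?_
    have hk' : k ≤ i := by simp at hk; omega
    have := G.Lpow_mem w₂ k (G.Lpow_mem w₁ (i - k) G.one_mem)
    rw [mul_one, show 0 + (i - k) + k = i by omega] at this
    exact this
  have h1 := quot_aux (Th (LL K x w₁) (LL K x w₂) (j + 1)) (Polynomial.degreeLT K (j + 2)) B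
  have h2 := quot_aux (Th (LL K x w₁) (LL K x w₂) (j + 2)) (Polynomial.degreeLT K (j + 3)) C
  rw [finrank_degreeLT] at h1 h2
  set V := Polynomial.degreeLT K (j + 2) ⊓ B.comap (Th (LL K x w₁) (LL K x w₂) (j + 1)) with hV
  have hVle : V ≤ Polynomial.degreeLT K (j + 2) := inf_le_left
  have i7 : FiniteDimensional K V := Submodule.finiteDimensional_of_le hVle
  have h3 : finrank K (B ⊔ (Polynomial.degreeLT K (j + 2)).map (Th (LL K x w₁) (LL K x w₂) (j + 1)) :
      Submodule K A) ≤ finrank K (P (j + 1)) := by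
    refine Submodule.finrank_mono (sup_le hB ?_)
    rintro _ ⟨p, _, rfl⟩
    exact hTh _ _
  have h4 : finrank K (P (j + 2)) ≤ finrank K (C ⊔ (Polynomial.degreeLT K (j + 3)).map
      (Th (LL K x w₁) (LL K x w₂) (j + 2)) : Submodule K A) :=
    Submodule.finrank_mono ((G.P_le u hw (j + 1)).trans (sup_le_sup_right hC' _))
  have hV0 : V ≠ ⊥ := by
    intro h0
    rw [h0, finrank_bot] at h1
    omega
  have h5 := polyV (j + 2) V hVle hV0
  have h6 : V ⊔ V.map (LinearMap.mulLeft K (Polynomial.X : Polynomial K)) ≤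
      Polynomial.degreeLT K (j + 3) ⊓ C.comap (Th (LL K x w₁) (LL K x w₂) (j + 2)) := by
    refine sup_le ?_ ?_
    · intro p hp
      refine ⟨Polynomial.degreeLT_mono (by omega) (hVle hp), ?_⟩
      rw [SetLike.mem_coe, Submodule.mem_comap, ← Th_s _ _ _ _ (hVle hp)]
      exact hBC _ _ hp.2
    · rintro _ ⟨p, hp, rfl⟩
      refine ⟨?_, ?_⟩
      · exact X_mul_mem (hVle hp)
      · rw [LinearMap.mulLeft_apply, SetLike.mem_coe, Submodule.mem_comap, ← Th_t]
        exact hBC _ _ hp.2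
  have h7 := Submodule.finrank_mono h6
  omega

end GA
end Graded
end Part3

section Part4
open Module
section Good
variable {K : Type*} [Field K] {A : Type*} [CommRing A] [Algebra K A]

lemma VPF_pow {T : Type*} {Q : Subalgebra K (T → K)} {ι : Type*} (s : Finset ι) (c : ι → T → K)
    (hc : ∀ i, c i ∈ Q) (z : ι → A) (g : T → A) (hg : ∀ t, g t = ∑ i ∈ s, c i t • z i) (n : ℕ) :
    ∀ b : A, VPF Q (fun t => g t ^ n * b) := by
  induction n with
  | zero => intro b; simpa using VPF.const Q b
  | succ n ih =>
    intro b
    have h : (fun t => g t ^ (n + 1) * b) = fun t => ∑ i ∈ s, c i t • (g t ^ n * (z i * b)) := by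
      funext t
      rw [pow_succ, mul_assoc]
      nth_rewrite 2 [hg t]
      rw [Finset.sum_mul, Finset.mul_sum]
      simp
    rw [h]
    exact VPF.sum s fun i _ => VPF.smul (hc i) (ih _)

lemma VPF_L (x : Fin 3 → A) (n : ℕ) (b : A) :
    VPF (PF3 K) (fun u => LL K x u ^ n * b) :=
  VPF_pow Finset.univ (fun i u => u i) (fun i => proj_mem_PF3 i) x _ (fun u => LL_apply x u) n b

lemma VPF_line (x : Fin 3 → A) (u v : Fin 3 → K) (n : ℕ) (b : A) :
    VPF (PF1 K) (fun t => LL K x (u + t • v) ^ n * b) :=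
  VPF_pow (Finset.univ : Finset (Fin 2)) (fun i t => if i = 0 then 1 else t)
    (fun i => by
      by_cases h : i = 0
      · simp only [h, if_true]; exact (PF1 K).one_mem
      · simp only [h, if_false]; exact id_mem_PF1)
    (fun i => if i = 0 then LL K x u else LL K x v) _
    (fun t => by simp [Fin.sum_univ_two]) n b

/-- points where all the ranks are maximal -/
def Good (P : ℕ → Submodule K A) (x : Fin 3 → A) (m : ℕ) (u : Fin 3 → K) : Prop :=
  ∀ i ∈ (Finset.range (2 * m + 3) ×ˢ Finset.range (2 * m + 3)), ∀ u' : Fin 3 → K,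
    finrank K (mm (LL K x u' ^ i.1) (P i.2)) ≤ finrank K (mm (LL K x u ^ i.1) (P i.2))

variable {P : ℕ → Submodule K A} {x : Fin 3 → A} {m : ℕ}

lemma Good.le {u : Fin 3 → K} (hu : Good P x m u) {n j : ℕ} (hn : n ≤ 2 * m + 2) (hj : j ≤ 2 * m + 2)
    (u' : Fin 3 → K) :
    finrank K (mm (LL K x u' ^ n) (P j)) ≤ finrank K (mm (LL K x u ^ n) (P j)) :=
  hu (n, j) (by simp; omega) u'

namespace GA

lemma good_gen (G : GA P x m) : Gen (Good P x m) := by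
  apply Gen.ball
  rintro ⟨n, j⟩ -
  have := G.fd j
  let f : (Fin 3 → K) → ℕ := fun u => finrank K (mm (LL K x u ^ n) (P j))
  have hN : ∀ u, f u ≤ finrank K (P j) := fun u => Submodule.finrank_map_le _ _
  let u₀ := Function.argmin (fun u => finrank K (P j) - f u)
  have hu₀ : ∀ u, f u ≤ f u₀ := by
    intro u
    have h1 : finrank K (P j) - f u₀ ≤ finrank K (P j) - f u :=
      Function.argmin_le (fun u => finrank K (P j) - f u) u
    have h2 := hN u
    have h3 := hN u₀
    omega
  obtain ⟨g, hg, hg0, h⟩ := rank_semicont (Q := PF3 K) (P j) (fun u => LL K x u ^ n)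
    (fun s _ => VPF_L x n s) u₀
  exact (Gen.of_PF3 hg hg0).mono fun u hu u' => (hu₀ u').trans (h u hu)

lemma L_ne (G : GA P x m) {u : Fin 3 → K} (hu : u ≠ 0) : LL K x u ≠ 0 := by
  intro h
  exact hu (G.L_inj (by rw [h, map_zero]))

lemma fin_pos (G : GA P x m) {j : ℕ} (hj : j ≤ 2 * m + 1) : 0 < finrank K (P j) := by
  have key : ∀ j, j ≤ m → 0 < finrank K (P j) := by
    intro j hj
    rcases Nat.lt_or_ge j 2 with h | h
    · interval_cases j
      · rw [G.f0]; omega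
      · rw [G.f1]; omega
    · rw [G.fi j h hj]; omega
  rcases Nat.lt_or_ge m j with h | h
  · rw [G.sym j hj]; exact key _ (by omega)
  · exact key j h

lemma good_ne (G : GA P x m) {u : Fin 3 → K} (hu : Good P x m u) : u ≠ 0 := by
  rintro rfl
  have h := hu.le (n := 1) (j := 0) (by omega) (by omega) (Pi.single 0 1)
  have h0 : mm (LL K x 0 ^ 1) (P 0) = ⊥ := by
    rw [eq_bot_iff]
    intro b hb
    obtain ⟨s, _, rfl⟩ := mem_mm.1 hb
    simp
  rw [h0, finrank_bot] at h
  have i1 := G.mm_fd' (LL K x (Pi.single 0 1) ^ 1) 0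
  have h2 : mm (LL K x (Pi.single 0 1) ^ 1) (P 0) = ⊥ := by
    apply Submodule.finrank_eq_zero.1; omega
  have h3 := mul_mem_mm (a := LL K x (Pi.single (M := fun _ => K) 0 1) ^ 1) G.one_mem
  rw [h2, Submodule.mem_bot, mul_one, pow_one] at h3
  refine G.L_ne (u := Pi.single 0 1) ?_ h3
  intro h
  have := congrFun h 0
  simp at this

variable [CharZero K]

lemma FO (G : GA P x m) {u : Fin 3 → K} (hu : Good P x m u) {n j : ℕ} (hn : n + 1 ≤ 2 * m + 2) (hj : j ≤ 2 * m + 2)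
    {b : A} (hb : b ∈ P j) (h0 : LL K x u ^ (n + 1) * b = 0) (v : Fin 3 → K) :
    ∃ b' ∈ P j, LL K x u ^ n * (LL K x v * b - LL K x u * b') = 0 := by
  have i1 := G.fd j
  set ℓ := LL K x u with hℓ
  set w := LL K x v with hw
  have hg : ∀ t : K, LL K x (u + t • v) = ℓ + t • w := fun t => by simp [hℓ, hw]
  have key : ∀ n : ℕ, ∃ q : K → A, (∀ b, VPF (PF1 K) (fun t => q t * b)) ∧
      (∀ t, LL K x (u + t • v) ^ (n + 1) = ℓ ^ (n + 1) + t • q t) ∧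
      q 0 = ((n : K) + 1) • (ℓ ^ n * w) := by
    intro n
    induction n with
    | zero =>
      refine ⟨fun _ => w, fun b => VPF.const _ _, fun t => ?_, by simp⟩
      rw [hg]; ring
    | succ n ih =>
      obtain ⟨q, hq, hq1, hq0⟩ := ih
      refine ⟨fun t => ℓ * q t + t • (w * q t) + ℓ ^ (n + 1) * w, fun b => ?_, fun t => ?_, ?_⟩
      · have h : (fun t => (ℓ * q t + t • (w * q t) + ℓ ^ (n + 1) * w) * b) =
            fun t => (q t * (ℓ * b) + t • (q t * (w * b))) + ℓ ^ (n + 1) * w * b := by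
          funext t
          simp only [add_mul, smul_mul_assoc]
          congr 2
          · ring
          · congr 1; ring
        rw [h]
        exact ((hq _).add (VPF.smul id_mem_PF1 (hq _))).add (VPF.const _ _)
      · rw [pow_succ, hq1, hg]
        simp only [Algebra.smul_def]
        ring
      · simp only [hq0, zero_smul, add_zero, Nat.cast_succ, mul_smul_comm]
        rw [add_smul ((n : K) + 1), one_smul]
        congr 1
        · congr 1; ring
  obtain ⟨q, hq, hq1, hq0⟩ := key n
  have hmem := closed_image (P j) (fun t => LL K x (u + t • v) ^ (n + 1))
    (fun s _ => VPF_line x u v (n + 1) s) (fun t => q t * b) (hq b) ?_ ?_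
  · simp only [zero_smul, add_zero] at hmem
    obtain ⟨s, hs, hsb⟩ := mem_mm.1 hmem
    rw [hq0] at hsb
    have hn0 : ((n : K) + 1) ≠ 0 := by exact_mod_cast Nat.succ_ne_zero n
    refine ⟨((n : K) + 1)⁻¹ • s, Submodule.smul_mem _ _ hs, ?_⟩
    have : ℓ ^ n * w * b = ((n : K) + 1)⁻¹ • (ℓ ^ (n + 1) * s) := by
      rw [hsb, smul_mul_assoc, smul_smul, inv_mul_cancel₀ hn0, one_smul]
    rw [mul_sub, ← mul_assoc, this, mul_smul_comm, mul_smul_comm, ← mul_assoc, ← pow_succ, sub_self]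
  · intro t ht
    refine mem_mm.2 ⟨t⁻¹ • b, Submodule.smul_mem _ _ hb, ?_⟩
    rw [hq1, mul_smul_comm, add_mul, h0, zero_add, smul_mul_assoc, smul_smul, inv_mul_cancel₀ ht,
      one_smul]
  · intro t
    have e : u + (0 : K) • v = u := by simp
    rw [e]
    exact hu.le hn hj _

lemma SO (G : GA P x m) {u : Fin 3 → K} (hu : Good P x m u) {j : ℕ} (hj : j ≤ 2 * m + 2) {a a' : A} (ha : a ∈ P j)
    (ha' : a' ∈ P j) (h0 : LL K x u * a = 0) (v : Fin 3 → K) (h1 : LL K x v * a = LL K x u * a') :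
    LL K x v * a' ∈ mm (LL K x u) (P j) := by
  have i1 := G.fd j
  have hmem := closed_image (P j) (fun t => LL K x (u + t • (-v)) ^ 1)
    (fun s _ => VPF_line x u (-v) 1 s) (fun _ => LL K x v * a') (VPF.const _ _) ?_ ?_
  · simpa using hmem
  · intro t ht
    refine mem_mm.2 ⟨(-(t⁻¹ * t⁻¹)) • (a + t • a'), ?_, ?_⟩
    · exact Submodule.smul_mem _ _ (Submodule.add_mem _ ha (Submodule.smul_mem _ _ ha'))
    · have : LL K x (u + t • (-v)) ^ 1 * (a + t • a') = (-(t * t)) • (LL K x v * a') := by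
        rw [pow_one, map_add, map_smul, map_neg]
        simp only [add_mul, mul_add, smul_mul_assoc, mul_smul_comm, neg_mul, h0, h1]
        module
      rw [mul_smul_comm, this, smul_smul]
      have : -(t⁻¹ * t⁻¹) * -(t * t) = 1 := by field_simp
      rw [this, one_smul]
  · intro t
    have e : u + (0 : K) • (-v) = u := by simp
    rw [e]
    exact hu.le (by omega) hj _

lemma NP (G : GA P x m) {u : Fin 3 → K} (hu : Good P x m u) {n : ℕ} (hn : n ≤ 2 * m + 1) : LL K x u ^ n ≠ 0 := by
  intro h0
  have key : ∀ j, j ≤ n → ∀ b ∈ P j, LL K x u ^ (n - j) * b = 0 := by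
    intro j
    induction j with
    | zero => intro _ b _; simp [h0]
    | succ j ih =>
      intro hj
      have ih' := ih (by omega)
      have hle : P (j + 1) ≤ LinearMap.ker (LinearMap.mulLeft K (LL K x u ^ (n - (j + 1)))) := by
        refine G.succ_le _ _ fun v b hb => ?_
        have h1 := ih' b hb
        rw [show n - j = (n - (j + 1)) + 1 by omega] at h1
        obtain ⟨b', hb', h2⟩ := G.FO hu (by omega) (by omega) hb h1 v
        rw [LinearMap.mem_ker, LinearMap.mulLeft_apply]
        have h3 := ih' b' hb'
        rw [show n - j = (n - (j + 1)) + 1 by omega, pow_succ, mul_assoc] at h3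
        rw [mul_sub, h3, sub_zero] at h2
        exact h2
      intro b hb
      simpa using hle hb
  have h1 := key n le_rfl
  have h2 : P n = ⊥ := by
    rw [eq_bot_iff]
    intro b hb
    simpa using h1 b hb
  have h3 := G.fin_pos hn
  rw [h2, finrank_bot] at h3
  omega

end GA
end Good
end Part4

section Part5
open Module
set_option linter.unusedSimpArgs false
section Chains
variable {K : Type*} [Field K] {A : Type*} [CommRing A] [Algebra K A]

/-- elements of degree `j` killed by the `n`-th power of the linear form -/
def ZZ (P : ℕ → Submodule K A) (x : Fin 3 → A) (u : Fin 3 → K) (n j : ℕ) : Submodule K A :=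
  P j ⊓ LinearMap.ker (LinearMap.mulLeft K (LL K x u ^ n))

variable {P : ℕ → Submodule K A} {x : Fin 3 → A} {m : ℕ} {u : Fin 3 → K}

lemma mem_ZZ {n j : ℕ} {b : A} : b ∈ ZZ P x u n j ↔ b ∈ P j ∧ LL K x u ^ n * b = 0 := by
  simp [ZZ]

lemma ZZ_le (n j : ℕ) : ZZ P x u n j ≤ P j := inf_le_left

lemma ZZ_mono {n n' : ℕ} (h : n ≤ n') (j : ℕ) : ZZ P x u n j ≤ ZZ P x u n' j := by
  intro b hb
  rw [mem_ZZ] at hb ⊢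
  refine ⟨hb.1, ?_⟩
  rw [show n' = (n' - n) + n by omega, pow_add, mul_assoc, hb.2, mul_zero]

lemma ZZ_zero (j : ℕ) : ZZ P x u 0 j = ⊥ := by
  rw [eq_bot_iff]
  intro b hb
  simpa using (mem_ZZ.1 hb).2

lemma mm_mono (a : A) {S T : Submodule K A} (h : S ≤ T) : mm a S ≤ mm a T := Submodule.map_mono h

/-- the sum of the image and the kernel parts -/
def EE (P : ℕ → Submodule K A) (x : Fin 3 → A) (u : Fin 3 → K) (n j : ℕ) : Submodule K A :=
  mm (LL K x u) (P j) ⊔ ZZ P x u n (j + 1)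

lemma EE_zero (j : ℕ) : EE P x u 0 j = mm (LL K x u) (P j) := by
  rw [EE, ZZ_zero, sup_bot_eq]

/-- dimension, with the carrier as a plain argument -/
noncomputable def dd (S : Submodule K A) : ℕ := finrank K S

lemma dd_def (S : Submodule K A) : finrank K S = dd S := rfl

namespace GA

lemma ZZ_fd (G : GA P x m) (n j : ℕ) : FiniteDimensional K (ZZ P x u n j) :=
  have := G.fd j
  Submodule.finiteDimensional_of_le (ZZ_le n j)

lemma mm_inf_ZZ (G : GA P x m) (n j : ℕ) :
    mm (LL K x u) (P j) ⊓ ZZ P x u n (j + 1) = mm (LL K x u) (ZZ P x u (n + 1) j) := by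
  ext b
  constructor
  · rintro ⟨h1, h2⟩
    obtain ⟨s, hs, rfl⟩ := mem_mm.1 h1
    refine mul_mem_mm (mem_ZZ.2 ⟨hs, ?_⟩)
    rw [pow_succ, mul_assoc]
    exact (mem_ZZ.1 h2).2
  · intro h
    obtain ⟨s, hs, rfl⟩ := mem_mm.1 h
    rw [mem_ZZ] at hs
    refine ⟨mul_mem_mm hs.1, mem_ZZ.2 ⟨G.Lmul_mem u hs.1, ?_⟩⟩
    rw [← mul_assoc, ← pow_succ]
    exact hs.2

lemma rk (G : GA P x m) (j : ℕ) : finrank K (mm (LL K x u) (P j)) + finrank K (ZZ P x u 1 j) = finrank K (P j) := by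
  have := G.fd j
  have h := rank_nullity (LinearMap.mulLeft K (LL K x u)) (P j)
  rw [ZZ, pow_one]
  exact h

lemma rkn (G : GA P x m) (n j : ℕ) :
    finrank K (mm (LL K x u ^ n) (P j)) + finrank K (ZZ P x u n j) = finrank K (P j) := by
  have := G.fd j
  exact rank_nullity (LinearMap.mulLeft K (LL K x u ^ n)) (P j)

lemma rkZ (G : GA P x m) (n j : ℕ) : finrank K (mm (LL K x u) (ZZ P x u (n + 1) j)) + finrank K (ZZ P x u 1 j)
    = finrank K (ZZ P x u (n + 1) j) := by
  have := G.ZZ_fd (u := u) (n + 1) j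
  have h := rank_nullity (LinearMap.mulLeft K (LL K x u)) (ZZ P x u (n + 1) j)
  have h2 : ZZ P x u (n + 1) j ⊓ LinearMap.ker (LinearMap.mulLeft K (LL K x u)) = ZZ P x u 1 j := by
    apply le_antisymm
    · rintro b ⟨h1, h2⟩
      refine mem_ZZ.2 ⟨(mem_ZZ.1 h1).1, ?_⟩
      simpa using h2
    · intro b hb
      refine ⟨ZZ_mono (by omega) j hb, ?_⟩
      simpa using (mem_ZZ.1 hb).2
  rw [h2] at h
  exact h

lemma rkE (G : GA P x m) (n j : ℕ) : finrank K (EE P x u n j) + finrank K (mm (LL K x u) (ZZ P x u (n + 1) j))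
    = finrank K (mm (LL K x u) (P j)) + finrank K (ZZ P x u n (j + 1)) := by
  have := G.mm_fd' (LL K x u) j
  have := G.ZZ_fd (u := u) n (j + 1)
  have h := Submodule.finrank_sup_add_finrank_inf_eq (mm (LL K x u) (P j)) (ZZ P x u n (j + 1))
  rw [G.mm_inf_ZZ] at h
  exact h

lemma EE_le (G : GA P x m) (n j : ℕ) : EE P x u n j ≤ P (j + 1) := sup_le (G.mm_L_le u j) (ZZ_le _ _)

lemma EE_fd (G : GA P x m) (n j : ℕ) : FiniteDimensional K (EE P x u n j) :=
  have := G.fd (j + 1)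
  Submodule.finiteDimensional_of_le (G.EE_le n j)

lemma mm_le_EE (G : GA P x m) (n j : ℕ) : finrank K (mm (LL K x u) (P j)) ≤ finrank K (EE P x u n j) :=
  have := G.EE_fd (u := u) n j
  Submodule.finrank_mono le_sup_left

lemma EE_eq {n j : ℕ} (h : ZZ P x u n (j + 1) ≤ mm (LL K x u) (P j)) :
    EE P x u n j = mm (LL K x u) (P j) := sup_eq_left.2 h

lemma ZZ_le_of_rank (G : GA P x m) {n j : ℕ} (h : finrank K (EE P x u n j) ≤ finrank K (mm (LL K x u) (P j))) :
    ZZ P x u n (j + 1) ≤ mm (LL K x u) (P j) := by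
  have := G.EE_fd (u := u) n j
  have h1 : mm (LL K x u) (P j) = EE P x u n j :=
    Submodule.eq_of_le_of_finrank_le le_sup_left h
  rw [h1]
  exact le_sup_right

/-- if the kernel part sits in the image then it is the image of the previous kernel part -/
lemma ZZ_down (G : GA P x m) {n j : ℕ} (h : ZZ P x u n (j + 1) ≤ mm (LL K x u) (P j)) :
    finrank K (ZZ P x u n (j + 1)) ≤ finrank K (ZZ P x u (n + 1) j) := by
  have h1 := G.rkE (u := u) n j
  rw [EE_eq h] at h1
  have h2 := G.rkZ (u := u) n j
  omega

variable [CharZero K]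

lemma FO' (G : GA P x m) (hu : Good P x m u) {n j : ℕ} (hn : n + 1 ≤ 2 * m + 2) (hj : j ≤ 2 * m + 2)
    {b : A} (hb : b ∈ ZZ P x u (n + 1) j) (v : Fin 3 → K) :
    LL K x v * b ∈ EE P x u n j := by
  rw [mem_ZZ] at hb
  obtain ⟨b', hb', h⟩ := G.FO hu hn hj hb.1 hb.2 v
  have : LL K x v * b = LL K x u * b' + (LL K x v * b - LL K x u * b') := by ring
  rw [this]
  refine Submodule.add_mem_sup (mul_mem_mm hb') (mem_ZZ.2 ⟨?_, h⟩)
  exact Submodule.sub_mem _ (G.Lmul_mem v hb.1) (G.Lmul_mem u hb')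

lemma LZ (G : GA P x m) (hu : Good P x m u) {n j : ℕ} (hn : n + 1 ≤ 2 * m + 2) (hj : j + 1 ≤ 2 * m + 2)
    (hd : finrank K (P (j + 1)) ≤ finrank K (EE P x u (n + 1) j) + (j + 1)) :
    finrank K (P (j + 2)) + finrank K (EE P x u (n + 1) j) ≤
      finrank K (EE P x u n (j + 1)) + finrank K (P (j + 1)) := by
  refine G.Ld u (G.good_ne hu) j _ _ (G.EE_le _ _) hd le_sup_left (G.EE_le _ _) ?_
  intro v b hb
  obtain ⟨y, hy, z, hz, rfl⟩ := Submodule.mem_sup.1 hb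
  rw [mul_add]
  refine Submodule.add_mem _ (Submodule.mem_sup_left ?_) (G.FO' hu hn hj hz v)
  obtain ⟨s, hs, rfl⟩ := mem_mm.1 hy
  rw [mul_left_comm]
  exact mul_mem_mm (G.Lmul_mem v hs)

lemma ZZ_deg0 (G : GA P x m) (hu : Good P x m u) {n : ℕ} (hn : n ≤ 2 * m + 1) : ZZ P x u n 0 = ⊥ := by
  rw [eq_bot_iff]
  intro b hb
  rw [mem_ZZ, G.one] at hb
  obtain ⟨hb, h⟩ := hb
  obtain ⟨c, rfl⟩ := Submodule.mem_span_singleton.1 hb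
  rw [mul_smul_comm, mul_one, smul_eq_zero] at h
  rcases h with h | h
  · simp [h]
  · exact absurd h (G.NP hu hn)

lemma CH1 (G : GA P x m) (hu : Good P x m u) {n : ℕ} (hn : n + 2 ≤ 2 * m + 1) (hE : finrank K (EE P x u n 1) ≤ 4) :
    finrank K (ZZ P x u (n + 1) 1) = 0 := by
  by_contra hZ
  have h1 := G.rkE (u := u) (n + 1) 0
  have h2 := G.rkZ (u := u) (n + 1) 0
  have h3 := G.rk (u := u) 0
  rw [G.ZZ_deg0 hu (by omega), G.ZZ_deg0 hu (by omega)] at h2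
  rw [G.ZZ_deg0 hu (by omega)] at h3
  rw [G.ZZ_deg0 hu (by omega)] at h1
  rw [finrank_bot, G.f0] at h3
  rw [finrank_bot] at h2
  have h4 := G.LZ hu (n := n) (j := 0) (by omega) (by omega) (by
    rw [zero_add, G.f1]; rw [zero_add] at h1; omega)
  have hm := G.hm
  have h5 := G.fi 2 le_rfl hm
  have h6 := G.f1
  simp only [dd_def, zero_add, Nat.add_assoc, Nat.reduceAdd] at *
  omega

lemma step1 (G : GA P x m) (hu : Good P x m u) : ∀ j, j < m → finrank K (ZZ P x u 1 j) = 0 := by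
  have hm := G.hm
  intro j
  induction j with
  | zero => intro _; rw [G.ZZ_deg0 hu (by omega), finrank_bot]
  | succ i ih =>
    intro hi
    have ih' := ih (by omega)
    have r1 := G.rk (u := u) i
    have r2 := G.rk (u := u) (i + 1)
    rcases Nat.lt_or_ge i 2 with h | h
    · interval_cases i
      · have h1 := G.Ldd u (G.good_ne hu) 1
        have h5 := G.fi 2 le_rfl hm
        have h6 := G.f1
        simp only [dd_def, zero_add, Nat.add_assoc, Nat.reduceAdd] at *
        omega
      · have h5 := G.fi 2 le_rfl hm
        have h7 := G.fi 3 (by omega) (by omega)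
        have h6 := G.f1
        have e1 := G.rkE (u := u) 1 1
        have e2 := G.rkZ (u := u) 1 1
        by_cases hE : finrank K (EE P x u 1 1) ≤ 3
        · have := G.CH1 hu (n := 1) (by omega) (by omega)
          simp only [dd_def, zero_add, Nat.add_assoc, Nat.reduceAdd] at *
          omega
        · have h4 := G.LZ hu (n := 0) (j := 1) (by omega) (by omega) (by simp only [dd_def, zero_add, Nat.add_assoc, Nat.reduceAdd] at *; omega)
          rw [EE_zero] at h4
          simp only [dd_def, zero_add, Nat.add_assoc, Nat.reduceAdd] at *
          omega
    · have h5 := G.fi i (by omega) (by omega)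
      have h6 := G.fi (i + 1) (by omega) (by omega)
      have h7 := G.fi (i + 2) (by omega) (by omega)
      have h8 := G.mm_le_EE (u := u) 1 i
      have h4 := G.LZ hu (n := 0) (j := i) (by omega) (by omega) (by simp only [dd_def, zero_add, Nat.add_assoc, Nat.reduceAdd] at *; omega)
      rw [EE_zero] at h4
      simp only [dd_def, zero_add, Nat.add_assoc, Nat.reduceAdd] at *
      omega

lemma rk1 (G : GA P x m) (hu : Good P x m u) {j : ℕ} (hj : j < m) :
    finrank K (mm (LL K x u) (P j)) = finrank K (P j) := by
  have := G.rk (u := u) j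
  have := G.step1 hu j hj
  omega

lemma CH (G : GA P x m) (hu : Good P x m u) (j : ℕ) : ∀ n, 2 ≤ j → j + 1 ≤ m → n + j + 1 ≤ 2 * m + 1 →
    ZZ P x u n (j + 1) ≤ mm (LL K x u) (P j) → finrank K (ZZ P x u n (j + 1)) ≤ 1 := by
  intro n hj hjm hn hZ
  have hm := G.hm
  induction j generalizing n with
  | zero => omega
  | succ i ih =>
    have hdown := G.ZZ_down hZ
    have hE := EE_eq hZ
    have r1 := G.rk1 hu (j := i) (by omega)
    have r2 := G.rk1 hu (j := i + 1) (by omega)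
    have h6 := G.fi (i + 1) (by omega) (by omega)
    have h7 := G.fi (i + 2) (by omega) (by omega)
    have h8 := G.mm_le_EE (u := u) (n + 1) i
    rcases Nat.lt_or_ge i 2 with h | h
    · obtain rfl : i = 1 := by omega
      have h5 := G.f1
      have hE4 : finrank K (EE P x u (n + 1) 1) ≤ 4 := by
        by_contra hc
        have h4 := G.LZ hu (n := n) (j := 1) (by omega) (by omega) (by simp only [dd_def, zero_add, Nat.add_assoc, Nat.reduceAdd] at *; omega)
        rw [hE] at h4
        simp only [dd_def, zero_add, Nat.add_assoc, Nat.reduceAdd] at *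
        omega
      have c := G.CH1 hu (n := n + 1) (by omega) hE4
      have e1 := G.rkE (u := u) (n + 1) 1
      have e2 := G.rkZ (u := u) (n + 1) 1
      simp only [dd_def, zero_add, Nat.add_assoc, Nat.reduceAdd] at *
      omega
    · have h5 := G.fi i (by omega) (by omega)
      have h4 := G.LZ hu (n := n) (j := i) (by omega) (by omega) (by omega)
      rw [hE] at h4
      have hZ' := G.ZZ_le_of_rank (u := u) (n := n + 1) (j := i) (by omega)
      have := ih (n + 1) (by omega) (by omega) (by omega) hZ'
      omega

lemma step2 (G : GA P x m) (hu : Good P x m u) : finrank K (ZZ P x u 1 m) ≤ 1 := by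
  obtain ⟨i, rfl⟩ : ∃ i, m = i + 1 := ⟨m - 1, by have := G.hm; omega⟩
  have hm := G.hm
  have r1 := G.rk1 hu (j := i) (by omega)
  have r2 := G.rk (u := u) (i + 1)
  have h6 := G.fi (i + 1) (by omega) (by omega)
  have h7 := G.fmid
  have h8 := G.mm_le_EE (u := u) 1 i
  have h4 := G.LZ hu (n := 0) (j := i) (by omega) (by omega)
  rw [EE_zero] at h4
  rcases Nat.lt_or_ge i 2 with h | h
  · obtain rfl : i = 1 := by omega
    have h5 := G.f1
    have e1 := G.rkE (u := u) 1 1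
    have e2 := G.rkZ (u := u) 1 1
    by_cases hE : finrank K (EE P x u 1 1) ≤ 4
    · have := G.CH1 hu (n := 1) (by omega) (by omega)
      simp only [dd_def, zero_add, Nat.add_assoc, Nat.reduceAdd] at *
      omega
    · simp only [dd_def, zero_add, Nat.add_assoc, Nat.reduceAdd] at *
      have := h4 (by omega)
      omega
  · have h5 := G.fi i (by omega) (by omega)
    by_cases hZ : ZZ P x u 1 (i + 1) ≤ mm (LL K x u) (P i)
    · exact G.CH hu i 1 (by omega) (by omega) (by omega) hZ
    · have := mt (G.ZZ_le_of_rank (u := u) (n := 1) (j := i)) hZ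
      simp only [dd_def, zero_add, Nat.add_assoc, Nat.reduceAdd] at *
      have := h4 (by omega)
      omega

lemma m2 (G : GA P x m) (hu : Good P x m u) (hm2 : m = 2) (hZ : ZZ P x u 1 2 ≤ mm (LL K x u) (P 1)) :
    finrank K (ZZ P x u 1 2) = 0 := by
  have e1 := G.rkE (u := u) 1 1
  have e2 := G.rkZ (u := u) 1 1
  have h5 := G.f1
  have r1 := G.rk1 hu (j := 1) (by omega)
  rw [EE_eq hZ] at e1
  have := G.CH1 hu (n := 1) (by omega) (by rw [EE_eq hZ]; omega)
  simp only [dd_def, zero_add, Nat.add_assoc, Nat.reduceAdd] at *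
  omega

end GA
end Chains
end Part5

section Part6
open Module
set_option linter.unusedSimpArgs false
set_option linter.unusedSectionVars false
set_option linter.unusedVariables false
section Final
variable {K : Type*} [Field K] {A : Type*} [CommRing A] [Algebra K A]
variable {P : ℕ → Submodule K A} {x : Fin 3 → A} {m : ℕ} {u : Fin 3 → K}

namespace GA

lemma ND (G : GA P x m) (k : ℕ) : ∀ i, i + k = 2 * m + 1 → ∀ b ∈ P i, (∀ c ∈ P k, b * c = 0) → b = 0 := by
  induction k with
  | zero =>
    intro i _ b _ h
    simpa using h 1 G.one_mem
  | succ k ih =>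
    intro i hi b hb h
    refine G.nd' (i := i) (by omega) hb fun v => ?_
    refine ih (i + 1) (by omega) _ (G.Lmul_mem v hb) fun c hc => ?_
    rw [mul_assoc, mul_left_comm]
    exact h _ (G.Lmul_mem v hc)

lemma exists_eps (G : GA P x m) : ∃ ε : A →ₗ[K] K, ∀ c ∈ P (2 * m + 1), ε c = 0 → c = 0 := by
  obtain ⟨c₀, hc₀, h⟩ := finrank_eq_one_iff'.1 G.ftop
  have hne : (c₀ : A) ∉ (⊥ : Submodule K A) := by simpa using hc₀
  obtain ⟨ε, hε, -⟩ := Submodule.exists_le_ker_of_notMem hne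
  refine ⟨ε, fun c hc h0 => ?_⟩
  obtain ⟨k, hk⟩ := h ⟨c, hc⟩
  have hk' : c = k • (c₀ : A) := by
    have := congrArg Subtype.val hk
    simpa using this.symm
  rw [hk', map_smul, smul_eq_mul, mul_eq_zero] at h0
  rcases h0 with h0 | h0
  · rw [hk', h0, zero_smul]
  · exact absurd h0 hε

lemma perp (G : GA P x m) {i j : ℕ} (hij : i + j = 2 * m + 1) (S T : Submodule K A) (hS : S ≤ P j) (hT : T ≤ P i)
    (hST : ∀ t ∈ T, ∀ s ∈ S, t * s = 0) : finrank K S + finrank K T ≤ finrank K (P j) := by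
  have i1 := G.fd i
  have i2 := G.fd j
  have i3 : FiniteDimensional K T := Submodule.finiteDimensional_of_le hT
  obtain ⟨ε, hε⟩ := G.exists_eps
  let B : A →ₗ[K] A →ₗ[K] K := (LinearMap.mul K A).compr₂ ε
  let θ : T →ₗ[K] Dual K (P j) := (B.compl₂ (P j).subtype).comp T.subtype
  have hθ : ∀ (t : T) (p : P j), θ t p = ε (t * p) := fun t p => rfl
  have hinj : Function.Injective θ := by
    rw [injective_iff_map_eq_zero]
    intro t ht
    apply Subtype.ext
    refine G.ND j i hij _ (hT t.2) fun c hc => ?_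
    have h1 := LinearMap.congr_fun ht ⟨c, hc⟩
    rw [hθ] at h1
    refine hε _ ?_ h1
    rw [← hij]
    exact G.mul _ _ _ _ (hT t.2) hc
  let S' : Submodule K (P j) := S.comap (P j).subtype
  have hS' : finrank K S' = finrank K S := by
    have : S'.map (P j).subtype = S := by
      rw [Submodule.map_comap_subtype]; exact inf_eq_right.2 hS
    rw [← this]
    exact LinearEquiv.finrank_eq (Submodule.equivMapOfInjective _ (P j).injective_subtype _)
  have hr : LinearMap.range θ ≤ S'.dualAnnihilator := by
    rintro _ ⟨t, rfl⟩
    rw [Submodule.mem_dualAnnihilator]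
    intro w hw
    have h0 : (t : A) * (w : A) = 0 := hST _ t.2 _ hw
    rw [hθ, h0, map_zero]
  have h1 := Subspace.finrank_add_finrank_dualAnnihilator_eq S'
  have h2 := Submodule.finrank_mono hr
  rw [LinearMap.finrank_range_of_inj hinj] at h2
  omega

lemma rkZ2 (G : GA P x m) (n k j : ℕ) (h : n ≤ k) : finrank K (mm (LL K x u ^ n) (ZZ P x u k j)) +
    finrank K (ZZ P x u n j) = finrank K (ZZ P x u k j) := by
  have := G.ZZ_fd (u := u) k j
  have h1 := rank_nullity (LinearMap.mulLeft K (LL K x u ^ n)) (ZZ P x u k j)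
  have h2 : ZZ P x u k j ⊓ LinearMap.ker (LinearMap.mulLeft K (LL K x u ^ n)) = ZZ P x u n j := by
    apply le_antisymm
    · rintro b ⟨h1, h2⟩
      exact ⟨(mem_ZZ.1 h1).1, h2⟩
    · intro b hb
      exact ⟨ZZ_mono h j hb, hb.2⟩
  rw [h2] at h1
  exact h1

variable [CharZero K]

lemma FO1 (G : GA P x m) (hu : Good P x m u) {a : A} (ha : a ∈ ZZ P x u 1 m) (v : Fin 3 → K) :
    ∃ a' ∈ P m, LL K x v * a = LL K x u * a' := by
  rw [mem_ZZ] at ha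
  obtain ⟨a', ha', h⟩ := G.FO hu (n := 0) (by omega) (by omega) ha.1 ha.2 v
  refine ⟨a', ha', ?_⟩
  rw [pow_zero, one_mul] at h
  exact sub_eq_zero.1 h

lemma a_sq (G : GA P x m) (hu : Good P x m u) {a : A} (ha : a ∈ ZZ P x u 1 m) : a * a = 0 := by
  have ha' := mem_ZZ.1 ha
  rw [pow_one] at ha'
  refine G.nd' (i := m + m) (by omega) (G.mul _ _ _ _ ha'.1 ha'.1) fun v => ?_
  obtain ⟨b, hb, h⟩ := G.FO1 hu ha v
  rw [← mul_assoc, h, mul_right_comm, ha'.2, zero_mul]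

lemma a_a' (G : GA P x m) (hu : Good P x m u) {a : A} (ha : a ∈ ZZ P x u 1 m) {v : Fin 3 → K} {a' : A}
    (h' : a' ∈ P m) (h : LL K x v * a = LL K x u * a') : a * a' = 0 := by
  have hZ := mem_ZZ.1 ha
  rw [pow_one] at hZ
  have key : ∀ (v : Fin 3 → K) (a' : A), a' ∈ P m → LL K x v * a = LL K x u * a' →
      LL K x u * (a' * a') = 0 := by
    intro v a' h' h
    obtain ⟨s, hs, hs'⟩ := mem_mm.1 (G.SO hu (by omega) hZ.1 h' hZ.2 v h)
    calc LL K x u * (a' * a') = (LL K x u * a') * a' := by ring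
      _ = (LL K x v * a') * a := by rw [← h]; ring
      _ = (LL K x u * a) * s := by rw [← hs']; ring
      _ = 0 := by rw [hZ.2, zero_mul]
  refine G.nd' (i := m + m) (by omega) (G.mul _ _ _ _ hZ.1 h') fun w => ?_
  obtain ⟨a'', h'', hw⟩ := G.FO1 hu ha w
  have k1 := key v a' h' h
  have k2 := key w a'' h'' hw
  have k3 := key (v + w) (a' + a'') (Submodule.add_mem _ h' h'') (by
    rw [map_add, add_mul, mul_add, h, hw])
  have k4 : (2 : K) • (LL K x u * (a' * a'')) = 0 := by
    rw [two_smul]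
    linear_combination k3 - k1 - k2
  have k5 : LL K x u * (a' * a'') = 0 := (smul_eq_zero.1 k4).resolve_left two_ne_zero
  rw [← mul_assoc, hw]
  linear_combination k5

lemma Q_dim (G : GA P x m) {a : A} (ha : a ∈ ZZ P x u 1 m) (h2 : 2 ≤ finrank K (mm a (P 1))) :
    finrank K (P m ⊓ LinearMap.ker (LinearMap.mulLeft K a) : Submodule K A) ≤ 2 * m := by
  have hZ := mem_ZZ.1 ha
  have h := G.perp (i := m) (j := m + 1) (by omega) (mm a (P 1))
    (P m ⊓ LinearMap.ker (LinearMap.mulLeft K a)) ?_ inf_le_left ?_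
  · have := G.fmid
    omega
  · intro b hb
    obtain ⟨s, hs, rfl⟩ := mem_mm.1 hb
    exact G.mul _ _ _ _ hZ.1 hs
  · rintro t ⟨_, ht⟩ s hs
    obtain ⟨p, hp, rfl⟩ := mem_mm.1 hs
    rw [SetLike.mem_coe, LinearMap.mem_ker, LinearMap.mulLeft_apply] at ht
    rw [← mul_assoc, mul_comm t a, ht, zero_mul]

lemma step3_aux (G : GA P x m) (hu : Good P x m u) {a : A} (ha : a ∈ ZZ P x u 1 m) {i : ℕ} (hi : m = i + 1)
    (h : ∀ v, ∃ b ∈ P i, LL K x v * a = LL K x u ^ 2 * b) :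
    finrank K (mm a (P 1)) ≤ finrank K (mm (LL K x u ^ 2) (ZZ P x u 3 i)) := by
  have hZ := mem_ZZ.1 ha
  rw [pow_one] at hZ
  have := G.ZZ_fd (u := u) 3 i
  apply Submodule.finrank_mono
  intro y hy
  obtain ⟨p, hp, rfl⟩ := mem_mm.1 hy
  rw [G.P1_eq] at hp
  obtain ⟨v, rfl⟩ := hp
  obtain ⟨b, hb, h'⟩ := h v
  rw [mul_comm, h']
  refine mul_mem_mm (mem_ZZ.2 ⟨hb, ?_⟩)
  rw [show LL K x u ^ 3 * b = LL K x u * (LL K x u ^ 2 * b) by ring, ← h', mul_left_comm, hZ.2,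
    mul_zero]

lemma Z2_dim (G : GA P x m) {i : ℕ} (hi : m = i + 1) :
    finrank K (mm (LL K x u ^ 2) (P i)) + finrank K (ZZ P x u 2 m) ≤ 2 * m + 2 := by
  rw [← G.fmid]
  refine G.perp (i := m) (j := m + 1) (by omega) _ _ ?_ (ZZ_le _ _) ?_
  · intro b hb
    obtain ⟨s, hs, rfl⟩ := mem_mm.1 hb
    have := G.Lpow_mem u 2 hs
    rwa [show i + 2 = m + 1 by omega] at this
  · intro t ht s hs
    obtain ⟨p, hp, rfl⟩ := mem_mm.1 hs
    rw [mem_ZZ] at ht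
    rw [← mul_assoc, mul_comm t, ht.2, zero_mul]

lemma step3 (G : GA P x m) (hu : Good P x m u) {a : A} (ha : a ∈ ZZ P x u 1 m) (ha0 : a ≠ 0) :
    finrank K (mm a (P 1)) ≤ 1 := by
  by_contra hcon
  have hm := G.hm
  obtain ⟨i, hi⟩ : ∃ i, m = i + 1 := ⟨m - 1, by omega⟩
  have hZ := mem_ZZ.1 ha
  rw [pow_one] at hZ
  have hQ := G.Q_dim ha (by omega)
  set Q := P m ⊓ LinearMap.ker (LinearMap.mulLeft K a) with hQdef
  have iP := G.fd m
  have iQ : FiniteDimensional K Q := Submodule.finiteDimensional_of_le inf_le_left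
  have hle : mm (LL K x u) (P i) ≤ Q := by
    intro b hb
    obtain ⟨s, hs, rfl⟩ := mem_mm.1 hb
    refine ⟨by rw [hi]; exact G.Lmul_mem u hs, ?_⟩
    rw [SetLike.mem_coe, LinearMap.mem_ker, LinearMap.mulLeft_apply, ← mul_assoc, mul_comm a, hZ.2,
      zero_mul]
  have haQ : a ∈ Q := ⟨hZ.1, by simpa using G.a_sq hu ha⟩
  have ha'Q : ∀ v, ∃ a' ∈ Q, LL K x v * a = LL K x u * a' := by
    intro v
    obtain ⟨a', h', h⟩ := G.FO1 hu ha v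
    exact ⟨a', ⟨h', by simpa using G.a_a' hu ha h' h⟩, h⟩
  have r1 := G.rk1 hu (j := i) (by omega)
  have s1 := G.step1 hu i (by omega)
  have s2 := G.step2 hu
  have d1 := G.Z2_dim (u := u) hi
  have d2 := G.rkn (u := u) 2 i
  have d3 := G.rkZ2 (u := u) 2 3 i (by omega)
  have d4 := G.rkZ (u := u) 2 i
  have d5 := G.rkZ (u := u) 1 i
  rcases Nat.lt_or_ge i 2 with h | h
  · obtain rfl : i = 1 := by omega
    subst hi
    have f1 := G.f1
    have hna : a ∉ mm (LL K x u) (P 1) := by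
      intro hmem
      have hspan : ZZ P x u 1 2 ≤ Submodule.span K {a} := by
        have i3 := G.ZZ_fd (u := u) 1 2
        have : Submodule.span K {a} = ZZ P x u 1 2 := by
          apply Submodule.eq_of_le_of_finrank_le
          · rw [Submodule.span_singleton_le_iff_mem]; exact ha
          · rw [finrank_span_singleton ha0]; exact s2
        exact this.ge
      have h0 := G.m2 hu rfl (hspan.trans ((Submodule.span_singleton_le_iff_mem _ _).2 hmem))
      have i3 := G.ZZ_fd (u := u) 1 2
      have h1 : ZZ P x u 1 2 = ⊥ := Submodule.finrank_eq_zero.1 h0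
      have h2 : a ∈ ZZ P x u 1 2 := ha
      rw [h1] at h2
      exact ha0 (by simpa using h2)
    have hQeq : mm (LL K x u) (P 1) ⊔ Submodule.span K {a} = Q := by
      apply Submodule.eq_of_le_of_finrank_le
      · exact sup_le hle ((Submodule.span_singleton_le_iff_mem _ _).2 haQ)
      · have i4 := G.mm_fd' (LL K x u) 1
        have : finrank K (mm (LL K x u) (P 1)) < finrank K
            (mm (LL K x u) (P 1) ⊔ Submodule.span K {a} : Submodule K A) := by
          apply Submodule.finrank_lt_finrank_of_lt
          refine lt_of_le_of_ne le_sup_left fun heq => hna ?_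
          rw [heq]
          exact Submodule.mem_sup_right (Submodule.mem_span_singleton_self a)
        omega
    have haux := G.step3_aux hu ha (i := 1) rfl (by
      intro v
      obtain ⟨a', h', h⟩ := ha'Q v
      rw [← hQeq] at h'
      obtain ⟨y, hy, z, hz, rfl⟩ := Submodule.mem_sup.1 h'
      obtain ⟨b, hb, rfl⟩ := mem_mm.1 hy
      obtain ⟨c, rfl⟩ := Submodule.mem_span_singleton.1 hz
      refine ⟨b, hb, ?_⟩
      rw [h, mul_add, mul_smul_comm, hZ.2, smul_zero, add_zero]
      ring)
    have e1 := G.rkE (u := u) 1 1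
    have c1 := G.CH1 hu (n := 1) (by omega) (by
      simp only [dd_def, zero_add, Nat.add_assoc, Nat.reduceAdd] at *; omega)
    have e2 := G.rkE (u := u) 2 1
    have c2 := G.CH1 hu (n := 2) (by omega) (by
      simp only [dd_def, zero_add, Nat.add_assoc, Nat.reduceAdd] at *; omega)
    simp only [dd_def, zero_add, Nat.add_assoc, Nat.reduceAdd] at *
    omega
  · have h5 := G.fi i (by omega) (by omega)
    have hQeq : mm (LL K x u) (P i) = Q :=
      Submodule.eq_of_le_of_finrank_le hle (by omega)
    have haux := G.step3_aux hu ha hi (by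
      intro v
      obtain ⟨a', h', h⟩ := ha'Q v
      rw [← hQeq] at h'
      obtain ⟨b, hb, rfl⟩ := mem_mm.1 h'
      refine ⟨b, hb, ?_⟩
      rw [h]
      ring)
    have hb0 : finrank K (ZZ P x u 2 i) ≠ 0 := by
      intro h0
      have i3 := G.ZZ_fd (u := u) 2 i
      have h1 : ZZ P x u 2 i = ⊥ := Submodule.finrank_eq_zero.1 h0
      rw [← hQeq] at haQ
      obtain ⟨b, hb, rfl⟩ := mem_mm.1 haQ
      have h2 : b ∈ ZZ P x u 2 i := mem_ZZ.2 ⟨hb, by rw [pow_two, mul_assoc]; exact hZ.2⟩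
      rw [h1, Submodule.mem_bot] at h2
      exact ha0 (by rw [h2, mul_zero])
    have g1 : finrank K (mm (LL K x u) (ZZ P x u 2 i)) ≤ finrank K (ZZ P x u 1 m) := by
      have i3 := G.ZZ_fd (u := u) 1 m
      apply Submodule.finrank_mono
      rw [← G.mm_inf_ZZ, hi]
      exact inf_le_right
    have g2 : mm (LL K x u) (ZZ P x u 3 i) = ZZ P x u 2 m := by
      have i3 := G.ZZ_fd (u := u) 2 m
      apply Submodule.eq_of_le_of_finrank_le
      · rw [← G.mm_inf_ZZ, hi]
        exact inf_le_right
      · simp only [dd_def, zero_add, Nat.add_assoc, Nat.reduceAdd] at *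
        omega
    have g3 : ZZ P x u 2 (i + 1) ≤ mm (LL K x u) (P i) := by
      rw [← hi, ← g2]
      exact mm_mono _ (ZZ_le _ _)
    have c := G.CH hu i 2 (by omega) (by omega) (by omega) g3
    rw [← hi, ← g2] at c
    simp only [dd_def, zero_add, Nat.add_assoc, Nat.reduceAdd] at *
    omega

end GA
end Final
end Part6

section Part7
open Module
section Final2
variable {K : Type*} [Field K] {A : Type*} [CommRing A] [Algebra K A]
variable {P : ℕ → Submodule K A} {x : Fin 3 → A} {m : ℕ} {u : Fin 3 → K}

/-- linear forms killing `a` -/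
def UU (K : Type*) [Field K] {A : Type*} [CommRing A] [Algebra K A] (x : Fin 3 → A) (a : A) :
    Submodule K (Fin 3 → K) := LinearMap.ker ((LinearMap.mulRight K a).comp (LL K x))

lemma mem_UU {a : A} {v : Fin 3 → K} : v ∈ UU K x a ↔ LL K x v * a = 0 := by
  simp [UU]

namespace GA

lemma UU_ne_top (G : GA P x m) {i : ℕ} (hi : i < 2 * m + 1) {a : A} (ha : a ∈ P i) (ha0 : a ≠ 0) :
    UU K x a ≠ ⊤ := by
  intro h
  refine ha0 (G.nd' hi ha fun v => mem_UU.1 ?_)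
  rw [h]
  trivial

lemma sup_top {U U' : Submodule K (Fin 3 → K)} (hU : finrank K U = 2) (h : ¬ U' ≤ U) :
    U ⊔ U' = ⊤ := by
  apply Submodule.eq_top_of_finrank_eq
  have h1 : finrank K U < finrank K (U ⊔ U' : Submodule K (Fin 3 → K)) :=
    Submodule.finrank_lt_finrank_of_lt (left_lt_sup.2 h)
  have h2 := Submodule.finrank_le (U ⊔ U')
  simp only [Module.finrank_fin_fun] at *
  omega

lemma not_le_of_ne {U U' : Submodule K (Fin 3 → K)} (hU : finrank K U = 2) (hU' : finrank K U' = 2)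
    (h : U ≠ U') : ¬ U ≤ U' := fun hle => h (Submodule.eq_of_le_of_finrank_eq hle (by rw [hU, hU']))

/-- the property of the annihilated elements that is used in the last step -/
def Spec (P : ℕ → Submodule K A) (x : Fin 3 → A) (m : ℕ) (a : A) : Prop :=
  a ∈ P m ∧ a ≠ 0 ∧ finrank K (UU K x a) = 2 ∧ a * a = 0

lemma spec_of_good (G : GA P x m) [CharZero K] (hu : Good P x m u) (hZ : ZZ P x u 1 m ≠ ⊥) :
    ∃ a, Spec P x m a ∧ u ∈ UU K x a := by
  obtain ⟨a, ha, ha0⟩ := Submodule.exists_mem_ne_zero_of_ne_bot hZ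
  have hZ := mem_ZZ.1 ha
  rw [pow_one] at hZ
  refine ⟨a, ⟨hZ.1, ha0, ?_, G.a_sq hu ha⟩, mem_UU.2 hZ.2⟩
  have h3 := G.step3 hu ha ha0
  have h1 := LinearMap.finrank_range_add_finrank_ker ((LinearMap.mulRight K a).comp (LL K x))
  have h2 : LinearMap.range ((LinearMap.mulRight K a).comp (LL K x)) = mm a (P 1) := by
    rw [LinearMap.range_comp, ← G.P1_eq]
    ext y
    simp [mm, mul_comm]
  rw [h2] at h1
  have h4 := Submodule.finrank_lt (G.UU_ne_top (by omega) hZ.1 ha0)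
  change _ + finrank K (UU K x a) = _ at h1
  simp only [Module.finrank_fin_fun] at *
  omega

lemma prod_zero (G : GA P x m) {a b : A} (ha : Spec P x m a) (hb : Spec P x m b) (h : UU K x a ≠ UU K x b) :
    a * b = 0 := by
  refine G.nd' (i := m + m) (by omega) (G.mul _ _ _ _ ha.1 hb.1) fun v => ?_
  have hv : v ∈ UU K x b ⊔ UU K x a := by
    rw [sup_top hb.2.2.1 (not_le_of_ne ha.2.2.1 hb.2.2.1 h)]
    trivial
  obtain ⟨p, hp, q, hq, rfl⟩ := Submodule.mem_sup.1 hv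
  rw [mem_UU] at hp hq
  rw [map_add]
  linear_combination a * hp + b * hq

lemma prod_ne (G : GA P x m) {a : A} (ha : Spec P x m a) {ι : Type*} (w : ι → Fin 3 → K) (s : Finset ι) :
    s.card ≤ m + 1 → (∀ i ∈ s, w i ∉ UU K x a) →
    (∏ i ∈ s, LL K x (w i)) * a ∈ P (m + s.card) ∧ (∏ i ∈ s, LL K x (w i)) * a ≠ 0 := by
  classical
  induction s using Finset.induction_on with
  | empty =>
    intro _ _
    simpa using ⟨ha.1, ha.2.1⟩
  | insert j s hj ih =>
    intro hc hw
    rw [Finset.card_insert_of_notMem hj] at hc ⊢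
    obtain ⟨h1, h2⟩ := ih (by omega) fun i hi => hw i (by simp [hi])
    rw [Finset.prod_insert hj, mul_assoc]
    refine ⟨G.Lmul_mem _ h1, fun h0 => ?_⟩
    refine h2 (G.nd' (by omega) h1 fun v => ?_)
    have hv : v ∈ UU K x a ⊔ Submodule.span K {w j} := by
      rw [sup_top ha.2.2.1]
      · trivial
      · intro hle
        exact hw j (by simp) (hle (Submodule.mem_span_singleton_self _))
    obtain ⟨p, hp, q, hq, rfl⟩ := Submodule.mem_sup.1 hv
    obtain ⟨c, rfl⟩ := Submodule.mem_span_singleton.1 hq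
    rw [mem_UU] at hp
    rw [map_add, map_smul, add_mul, smul_mul_assoc, h0, smul_zero, add_zero, mul_left_comm, hp,
      mul_zero]

theorem exists_inj (G : GA P x m) [CharZero K] : ∃ u, ZZ P x u 1 m = ⊥ := by
  classical
  by_contra! hcon
  have hseq := exists_seq_of_forall_finset_exists (Spec P x m) (fun a b => UU K x a ≠ UU K x b) (by
    intro s hs
    have hg : Gen (fun u => ∀ a ∈ s, u ∉ UU K x a) := by
      apply Gen.ball
      intro a ha
      exact Gen.notMem_submodule _ (G.UU_ne_top (by omega) (hs a ha).1 (hs a ha).2.1)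
    obtain ⟨u, hu, hus⟩ := (G.good_gen.and hg).exists
    obtain ⟨a, ha, hau⟩ := G.spec_of_good hu (hcon u)
    refine ⟨a, ha, fun b hb heq => hus b hb ?_⟩
    rw [heq]
    exact hau)
  obtain ⟨f, hf, hff⟩ := hseq
  have hne : ∀ i j : ℕ, i ≠ j → UU K x (f i) ≠ UU K x (f j) := by
    intro i j hij
    rcases Nat.lt_or_gt_of_ne hij with h | h
    · exact hff i j h
    · exact (hff j i h).symm
  have hmul : ∀ i j : ℕ, f i * f j = 0 := by
    intro i j
    by_cases h : i = j
    · subst h; exact (hf i).2.2.2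
    · exact G.prod_zero (hf i) (hf j) (hne i j h)
  have hli : LinearIndependent K (fun i : Fin (m + 2) => f i) := by
    rw [Fintype.linearIndependent_iff]
    intro c hc j
    have hw : ∀ i : Fin (m + 2), ∃ w, i ≠ j → w ∈ UU K x (f i) ∧ w ∉ UU K x (f j) := by
      intro i
      by_cases h : i = j
      · exact ⟨0, fun h' => absurd h h'⟩
      · have := not_le_of_ne (hf i).2.2.1 (hf j).2.2.1 (hne i j (by
          intro h'; exact h (Fin.ext h')))
        obtain ⟨w, h1, h2⟩ := SetLike.not_le_iff_exists.1 this
        exact ⟨w, fun _ => ⟨h1, h2⟩⟩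
    choose w hw using hw
    have hcard : (Finset.univ.erase j).card = m + 1 := by
      rw [Finset.card_erase_of_mem (Finset.mem_univ j)]; simp
    obtain ⟨-, hn0⟩ := G.prod_ne (hf j) w (Finset.univ.erase j) hcard.le
      (fun i hi => (hw i (Finset.ne_of_mem_erase hi)).2)
    set pr := ∏ i ∈ Finset.univ.erase j, LL K x (w i) with hpr
    have h1 := congrArg (fun y => pr * y) hc
    simp only [Finset.mul_sum, mul_zero, mul_smul_comm] at h1
    rw [Finset.sum_eq_single j] at h1
    · exact (smul_eq_zero.1 h1).resolve_right hn0
    · intro i _ hij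
      have h2 : pr * f i = 0 := by
        rw [hpr, ← Finset.mul_prod_erase (Finset.univ.erase j) _ (Finset.mem_erase.2
          ⟨hij, Finset.mem_univ i⟩), mul_right_comm, mem_UU.1 (hw i hij).1, zero_mul]
      rw [h2, smul_zero]
    · intro h
      exact absurd (Finset.mem_univ j) h
  obtain ⟨u, hu⟩ := G.good_gen.exists
  set N := Submodule.span K (Set.range fun i : Fin (m + 2) => f i) with hN
  have hNd : finrank K N = m + 2 := by
    rw [hN, finrank_span_eq_card hli]; simp
  have hNP : N ≤ P m := by
    rw [hN, Submodule.span_le]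
    rintro _ ⟨i, rfl⟩
    exact (hf i).1
  have iP := G.fd m
  have iN : FiniteDimensional K N := Submodule.finiteDimensional_of_le hNP
  have hNN : ∀ a ∈ N, ∀ b ∈ N, a * b = 0 := by
    intro a ha b hb
    induction ha using Submodule.span_induction with
    | mem a ha =>
      obtain ⟨i, rfl⟩ := ha
      induction hb using Submodule.span_induction with
      | mem b hb =>
        obtain ⟨j, rfl⟩ := hb
        exact hmul i j
      | zero => rw [mul_zero]
      | add b c _ _ h1 h2 => rw [mul_add, h1, h2, add_zero]
      | smul r b _ h1 => rw [mul_smul_comm, h1, smul_zero]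
    | zero => rw [zero_mul]
    | add b c _ _ h1 h2 => rw [add_mul, h1, h2, add_zero]
    | smul r b _ h1 => rw [smul_mul_assoc, h1, smul_zero]
  have hp := G.perp (i := m + 1) (j := m) (by omega) N (mm (LL K x u) N) hNP
    ((mm_mono _ hNP).trans (G.mm_L_le u m)) (by
      intro t ht s hs
      obtain ⟨r, hr, rfl⟩ := mem_mm.1 ht
      rw [mul_assoc, hNN _ hr _ hs, mul_zero])
  have hr := rank_nullity (LinearMap.mulLeft K (LL K x u)) N
  have hk : finrank K (N ⊓ LinearMap.ker (LinearMap.mulLeft K (LL K x u)) : Submodule K A) ≤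
      finrank K (ZZ P x u 1 m) := by
    have i3 := G.ZZ_fd (u := u) 1 m
    apply Submodule.finrank_mono
    rintro y ⟨h1, h2⟩
    refine mem_ZZ.2 ⟨hNP h1, ?_⟩
    simpa using h2
  have h2 := G.step2 hu
  have hfm := G.fi m G.hm le_rfl
  change finrank K (mm (LL K x u) N) + _ = _ at hr
  omega

theorem wlp (G : GA P x m) [CharZero K] : ∃ u, ∀ i, (∀ a ∈ P i, LL K x u * a = 0 → a = 0) ∨
    (∀ b ∈ P (i + 1), ∃ a ∈ P i, LL K x u * a = b) := by
  obtain ⟨u, hu⟩ := G.exists_inj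
  have hm := G.hm
  refine ⟨u, fun i => ?_⟩
  rcases Nat.lt_or_ge m i with h | h
  · right
    have key : ∀ k, P (m + k + 1) ≤ mm (LL K x u) (P (m + k)) := by
      intro k
      induction k with
      | zero =>
        have i1 := G.fd (m + 1)
        have h1 := G.rk (u := u) m
        rw [hu, finrank_bot, G.fi m hm le_rfl] at h1
        have h2 := G.fmid
        have : mm (LL K x u) (P m) = P (m + 1) :=
          Submodule.eq_of_le_of_finrank_le (G.mm_L_le u m) (by omega)
        exact this.ge
      | succ k ih =>
        refine G.succ_le _ _ fun v b hb => ?_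
        obtain ⟨s, hs, rfl⟩ := mem_mm.1 (ih hb)
        rw [mul_left_comm]
        exact mul_mem_mm (G.Lmul_mem v hs)
    have := key (i - m)
    rw [show m + (i - m) = i by omega] at this
    intro b hb
    exact mem_mm.1 (this hb)
  · left
    have key : ∀ k i, i + k = m → ∀ a ∈ P i, LL K x u * a = 0 → a = 0 := by
      intro k
      induction k with
      | zero =>
        rintro i rfl a ha h0
        have : a ∈ ZZ P x u 1 (i + 0) := mem_ZZ.2 ⟨ha, by rw [pow_one]; exact h0⟩
        rw [hu] at this
        simpa using this
      | succ k ih =>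
        intro i hi a ha h0
        refine G.nd' (by omega) ha fun v => ?_
        refine ih (i + 1) (by omega) _ (G.Lmul_mem v ha) ?_
        rw [mul_left_comm, h0, mul_zero]
    exact key (m - i) i (by omega)

end GA
end Final2
end Part7

section Part8
section Inst
variable {K : Type*} [Field K] {I : Ideal (MvPolynomial (Fin 3) K)}

lemma mem_piece {i : ℕ} {a : MvPolynomial (Fin 3) K ⧸ I} :
    a ∈ piece I i ↔ ∃ p : MvPolynomial (Fin 3) K, p.IsHomogeneous i ∧ Ideal.Quotient.mk I p = a := by
  simp only [piece, Submodule.mem_map]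
  exact Iff.rfl

lemma piece_zero_eq : piece I 0 = Submodule.span K {1} := by
  ext a
  rw [mem_piece, Submodule.mem_span_singleton]
  constructor
  · rintro ⟨p, hp, rfl⟩
    obtain ⟨c, rfl⟩ : ∃ c, p = C c :=
      ⟨_, totalDegree_eq_zero_iff_eq_C.1 ((totalDegree_zero_iff_isHomogeneous _).2 hp)⟩
    refine ⟨c, ?_⟩
    rw [← Algebra.algebraMap_eq_smul_one]
    rfl
  · rintro ⟨c, rfl⟩
    refine ⟨C c, isHomogeneous_C _ _, ?_⟩
    rw [← Algebra.algebraMap_eq_smul_one]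
    rfl

lemma piece_succ_eq (i : ℕ) :
    piece I (i + 1) = ⨆ j, mm (Ideal.Quotient.mk I (X j)) (piece I i) := by
  apply le_antisymm
  · intro a ha
    obtain ⟨p, hp, rfl⟩ := mem_piece.1 ha
    rw [p.as_sum, map_sum]
    refine Submodule.sum_mem _ fun d hd => ?_
    have hdeg : d.degree = i + 1 := by
      rw [Finsupp.degree_eq_weight_one]
      exact hp (mem_support_iff.1 hd)
    have hne : d ≠ 0 := by
      rintro rfl
      simp at hdeg
    obtain ⟨j, hj⟩ := Finsupp.ne_iff.1 hne
    have hle : Finsupp.single j 1 ≤ d := by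
      rw [Finsupp.single_le_iff]
      exact Nat.one_le_iff_ne_zero.2 hj
    have hd' : d = Finsupp.single j 1 + (d - Finsupp.single j 1) := (add_tsub_cancel_of_le hle).symm
    set e := d - Finsupp.single j 1 with he
    have hedeg : e.degree = i := by
      rw [hd', map_add, Finsupp.degree_single] at hdeg
      omega
    have hmon : monomial d (coeff d p) = X j * monomial e (coeff d p) := by
      rw [X, monomial_mul, ← hd', one_mul]
    rw [hmon, map_mul]
    refine Submodule.mem_iSup_of_mem j (mul_mem_mm (mem_piece.2 ⟨_, ?_, rfl⟩))
    exact isHomogeneous_monomial _ hedeg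
  · refine iSup_le fun j => ?_
    intro b hb
    obtain ⟨s, hs, rfl⟩ := mem_mm.1 hb
    obtain ⟨p, hp, rfl⟩ := mem_piece.1 hs
    refine mem_piece.2 ⟨X j * p, ?_, map_mul _ _ _⟩
    rw [add_comm]
    exact (isHomogeneous_X K j).mul hp

lemma piece_fd (i : ℕ) : FiniteDimensional K (piece I i) := by
  induction i with
  | zero => rw [piece_zero_eq]; infer_instance
  | succ i ih =>
    rw [piece_succ_eq]
    have : ∀ j, FiniteDimensional K (mm (Ideal.Quotient.mk I (X j)) (piece I i)) := by
      intro j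
      unfold mm
      infer_instance
    infer_instance

lemma piece_nd {d : ℕ} (hI : IsHomogIdeal I) (hs : socle I ≤ piece I d) {i : ℕ} (hi : i < d)
    {a : MvPolynomial (Fin 3) K ⧸ I} (ha : a ∈ piece I i)
    (h : ∀ j, Ideal.Quotient.mk I (X j) * a = 0) : a = 0 := by
  have h1 : a ∈ socle I := by
    simp only [socle, Submodule.mem_iInf, LinearMap.mem_ker, LinearMap.mulLeft_apply]
    exact h
  obtain ⟨q, hq, hqa⟩ := mem_piece.1 (hs h1)
  obtain ⟨p, hp, rfl⟩ := mem_piece.1 ha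
  have h2 : p - q ∈ I := Ideal.Quotient.eq.1 hqa.symm
  have h3 := hI _ h2 i
  rw [map_sub, homogeneousComponent_of_mem ((mem_homogeneousSubmodule _ _).2 hp),
    homogeneousComponent_of_mem ((mem_homogeneousSubmodule _ _).2 hq), if_pos rfl,
    if_neg (by omega), sub_zero] at h3
  exact Ideal.Quotient.eq_zero_iff_mem.2 h3

end Inst
end Part8

/-- Any artinian Gorenstein algebra of codimension 3 with socle degree `2m+1` (`m ≥ 1`)
and h-vector `(1,3,6,8,…,2m,2m+2,2m+2,2m,…,8,6,3,1)` satisfies the WLP. -/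
theorem wlp_odd_1368 {K : Type*} [Field K] [IsAlgClosed K] [CharZero K] (m : ℕ)
    (hm : 1 ≤ m)
    (I : Ideal (MvPolynomial (Fin 3) K))
    (hAG : IsArtinianGorenstein I (2 * m + 1))
    (h0 : hf I 0 = 1) (h1 : hf I 1 = 3)
    (hfirst : ∀ i : ℕ, 2 ≤ i → i ≤ m → hf I i = 2 * i + 2)
    (hmid : hf I (m + 1) = 2 * m + 2)
    (hsecond : ∀ i : ℕ, m + 1 ≤ i → i ≤ 2 * m + 1 → hf I i = hf I (2 * m + 1 - i)) :
    WLP I := by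
  have hm2 : 2 ≤ m := by
    by_contra hlt
    have hm1 : m = 1 := by omega
    subst hm1
    have h2 := hsecond 2 (by norm_num) (by norm_num)
    norm_num at h2 hmid
    omega
  obtain ⟨hI, htop, -, hsym, -, hsoc⟩ := hAG
  have G : GA (piece I) (fun j => Ideal.Quotient.mk I (X j)) m :=
    { hm := hm2
      fd := piece_fd
      one := piece_zero_eq
      succ := piece_succ_eq
      mul := by
        intro i j a b ha hb
        obtain ⟨p, hp, rfl⟩ := mem_piece.1 ha
        obtain ⟨q, hq, rfl⟩ := mem_piece.1 hb
        exact mem_piece.2 ⟨p * q, hp.mul hq, map_mul _ _ _⟩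
      nd := fun i hi a ha h => piece_nd hI hsoc hi ha h
      ftop := htop
      sym := hsym
      f0 := h0
      f1 := h1
      fi := hfirst
      fmid := hmid }
  obtain ⟨u, hu⟩ := G.wlp
  refine ⟨∑ i, u i • X i, ?_, ?_⟩
  · refine IsHomogeneous.sum _ _ _ fun i _ => ?_
    rw [smul_eq_C_mul]
    simpa using (isHomogeneous_C (Fin 3) (u i)).mul (isHomogeneous_X K i)
  · have hmk : Ideal.Quotient.mk I (∑ i, u i • X i) =
        LL K (fun j => Ideal.Quotient.mk I (X j)) u := by
      rw [LL_apply, map_sum]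
      rfl
    rw [hmk]
    exact hu
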